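/- arXiv:2502.07308 — 6 statements merged into one kernel-verified Lean document; each statement's English description precedes it below -/
import Mathlib

section
/- There is an absolute constant A > 0 such that for every ρ, ε ∈ (0,1) there exist a finite alphabet Σ with |Σ| ≤ 2^(2^((1/ε)^A)) and infinitely many n ∈ ℕ for which there exists a code C ⊆ Σ^n with rate at least ρ such that for every g ∈ Σ^n, the list at radius 1−ρ−ε satisfies |{h ∈ C : Δ(g,h) ≤ 1−ρ−ε}| ≤ A/ε. -/
open Finset
open scoped Classical

noncomputable section

/-- Fractional Hamming distance. -/
def hamFrac {ι A : Type*} [Fintype ι] (x y : ι → A) : ℝ :=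
  ((Finset.univ.filter fun i => x i ≠ y i).card : ℝ) / (Fintype.card ι)

/-- A union bound: if `N * (K * V) ^ L < N ^ L`, where `N` is the number of words and `V` bounds
the size of the sets `B g`, then some sequence of `K` words meets each `B g` fewer than `L` times. -/
lemma exists_forall_card_mem_lt {W : Type*} [Fintype W] [Nonempty W] (B : W → Finset W) {K L : ℕ} {V : ℝ}
    (hLK : L ≤ K) (hB : ∀ g, ((B g).card : ℝ) ≤ V)
    (h : (Fintype.card W : ℝ) * (K * V) ^ L < (Fintype.card W : ℝ) ^ L) :
    ∃ f : Fin K → W, ∀ g, (univ.filter fun k => f k ∈ B g).card < L := by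
  by_contra! hbad
  set N : ℝ := (Fintype.card W : ℝ) with hN
  have hcover : (univ : Finset (Fin K → W)) ⊆
      (univ ×ˢ powersetCard L univ).biUnion fun q : W × Finset (Fin K) =>
        Fintype.piFinset fun k => if k ∈ q.2 then B q.1 else univ := by
    intro f _
    obtain ⟨g, hg⟩ := hbad f
    obtain ⟨S, hS, hSL⟩ := exists_subset_card_eq hg
    refine mem_biUnion.2 ⟨(g, S), by simp [mem_powersetCard, hSL], ?_⟩
    refine Fintype.mem_piFinset.2 fun k => ?_
    by_cases hk : k ∈ S
    · simpa [hk] using hS hk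
    · simp [hk]
  have hcard : N ^ K ≤ ∑ q ∈ (univ : Finset W) ×ˢ powersetCard L (univ : Finset (Fin K)),
      V ^ L * N ^ (K - L) := by
    have h1 := (card_le_card hcover).trans card_biUnion_le
    have h2 : N ^ K ≤ ∑ q ∈ (univ : Finset W) ×ˢ powersetCard L (univ : Finset (Fin K)),
        ((Fintype.piFinset fun k => if k ∈ q.2 then B q.1 else univ).card : ℝ) := by
      rw [card_univ, Fintype.card_fun, Fintype.card_fin] at h1
      rw [hN]
      exact_mod_cast h1
    refine h2.trans (sum_le_sum fun q hq => ?_)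
    have hq2 : q.2.card = L := (mem_powersetCard.1 (mem_product.1 hq).2).2
    have hcompl : (univ.filter fun k => k ∉ q.2).card = K - L := by
      rw [← hq2, filter_not, card_sdiff]
      simp
    rw [Fintype.card_piFinset]
    simp only [apply_ite card, prod_ite, prod_const, filter_mem_eq_inter, univ_inter, hq2, hcompl,
      card_univ]
    push_cast
    gcongr
    exact hB q.1
  have hNpos : 0 < N := by
    rw [hN]
    exact_mod_cast Fintype.card_pos
  have hV : 0 ≤ V := (Nat.cast_nonneg _).trans (hB (Classical.arbitrary W))
  rw [sum_const, card_product, card_powersetCard, card_univ, card_univ, Fintype.card_fin,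
    nsmul_eq_mul, Nat.cast_mul] at hcard
  have hchoose : (K.choose L : ℝ) ≤ (K : ℝ) ^ L := by
    exact_mod_cast Nat.choose_le_pow K L
  have : N ^ K < N ^ K :=
    calc N ^ K ≤ N * (K.choose L) * (V ^ L * N ^ (K - L)) := hcard
      _ ≤ N * (K : ℝ) ^ L * (V ^ L * N ^ (K - L)) := by gcongr
      _ = N * (K * V) ^ L * N ^ (K - L) := by ring
      _ < N ^ L * N ^ (K - L) := by gcongr
      _ = N ^ K := by rw [← pow_add, Nat.add_sub_cancel' hLK]
  exact this.false

lemma hamFrac_nonneg {ι A : Type*} [Fintype ι] (x y : ι → A) : 0 ≤ hamFrac x y := by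
  unfold hamFrac
  positivity

lemma hamFrac_self {ι A : Type*} [Fintype ι] (x : ι → A) : hamFrac x x = 0 := by
  simp [hamFrac]

/-- A Hamming ball of fractional radius `p` has at most `2 ^ n * M ^ (p * n)` elements. -/
lemma card_hamFrac_le {n M : ℕ} (hn : 0 < n) (hM : 1 ≤ M) (p : ℝ) (g : Fin n → Fin M) :
    ((univ.filter fun h => hamFrac g h ≤ p).card : ℝ) ≤ 2 ^ n * (M : ℝ) ^ (p * n) := by
  have hcover : (univ.filter fun h => hamFrac g h ≤ p) ⊆
      (univ.filter fun S : Finset (Fin n) => (S.card : ℝ) ≤ p * n).biUnion fun S =>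
        Fintype.piFinset fun i => if i ∈ S then univ else {g i} := by
    intro h hh
    refine mem_biUnion.2 ⟨univ.filter fun i => g i ≠ h i, ?_, ?_⟩
    · have := (mem_filter.1 hh).2
      rw [hamFrac, div_le_iff₀ (by simpa using hn)] at this
      simpa using this
    · refine Fintype.mem_piFinset.2 fun i => ?_
      by_cases hi : g i = h i <;> simp [hi]
  have h1 : ((univ.filter fun h => hamFrac g h ≤ p).card : ℝ) ≤
      ∑ S ∈ univ.filter fun S : Finset (Fin n) => (S.card : ℝ) ≤ p * n,
        ((Fintype.piFinset fun i => if i ∈ S then univ else {g i}).card : ℝ) := by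
    exact_mod_cast (card_le_card hcover).trans card_biUnion_le
  have h2 : ∀ S ∈ univ.filter fun S : Finset (Fin n) => (S.card : ℝ) ≤ p * n,
      ((Fintype.piFinset fun i => if i ∈ S then univ else {g i}).card : ℝ)
        ≤ (M : ℝ) ^ (p * n) := by
    intro S hS
    rw [Fintype.card_piFinset]
    simp only [apply_ite card, prod_ite, prod_const, filter_mem_eq_inter, univ_inter, card_univ,
      Fintype.card_fin, card_singleton, one_pow, mul_one]
    rw [Nat.cast_pow, ← Real.rpow_natCast]
    exact Real.rpow_le_rpow_of_exponent_le (by exact_mod_cast hM) (mem_filter.1 hS).2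
  refine h1.trans ((sum_le_card_nsmul _ _ _ h2).trans ?_)
  rw [nsmul_eq_mul]
  gcongr
  have := card_filter_le (univ : Finset (Finset (Fin n))) fun S => (S.card : ℝ) ≤ p * n
  rw [card_univ, Fintype.card_finset, Fintype.card_fin] at this
  exact_mod_cast this

/-- Existence of list-decodable codes of length `n`, given that the union bound over a random
sequence of `L * ⌈M ^ (ρ * n)⌉` words succeeds. -/
lemma exists_code_card_list_lt {n M L : ℕ} (hn : 0 < n) (hM : 1 ≤ M) {ρ p : ℝ} (hp : 0 ≤ p)
    (h : (M : ℝ) ^ n * ((L * ⌈(M : ℝ) ^ (ρ * n)⌉₊ : ℕ) * (2 ^ n * (M : ℝ) ^ (p * n))) ^ L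
      < ((M : ℝ) ^ n) ^ L) :
    ∃ C : Set (Fin n → Fin M), (M : ℝ) ^ (ρ * (n : ℝ)) ≤ (Nat.card C : ℝ) ∧
      ∀ g : Fin n → Fin M,
        Nat.card {h : Fin n → Fin M | h ∈ C ∧ hamFrac g h ≤ p} < L := by
  have hceil : 1 ≤ ⌈(M : ℝ) ^ (ρ * n)⌉₊ :=
    Nat.one_le_ceil_iff.2 (Real.rpow_pos_of_pos (by exact_mod_cast hM) _)
  have : Nonempty (Fin n → Fin M) := ⟨fun _ => ⟨0, hM⟩⟩
  obtain ⟨f, hf⟩ := exists_forall_card_mem_lt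
    (fun g : Fin n → Fin M => univ.filter fun h => hamFrac g h ≤ p)
    (K := L * ⌈(M : ℝ) ^ (ρ * n)⌉₊) (L := L) (Nat.le_mul_of_pos_right _ hceil)
    (card_hamFrac_le hn hM p) (by simpa using h)
  have hL : 0 < L := (Nat.zero_le _).trans_lt (hf fun _ => ⟨0, hM⟩)
  refine ⟨↑(univ.image f), ?_, fun g => ?_⟩
  · have hfib : ∀ w ∈ univ.image f, (univ.filter fun k => f k = w).card ≤ L := fun w _ =>
      (card_le_card fun k hk => by
        have : f k = w := (mem_filter.1 hk).2
        simp [this, hamFrac_self, hp]).trans (hf w).le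
    have hK := card_le_mul_card_image univ L hfib
    rw [card_univ, Fintype.card_fin] at hK
    have := Nat.le_of_mul_le_mul_left hK hL
    rw [Nat.card_coe_set_eq, Set.ncard_coe_finset]
    exact (Nat.le_ceil _).trans (by exact_mod_cast this)
  · have hsub : {h : Fin n → Fin M | h ∈ (↑(univ.image f) : Set _) ∧ hamFrac g h ≤ p} ⊆
        ↑((univ.filter fun k => f k ∈ univ.filter fun h => hamFrac g h ≤ p).image f) := by
      rintro _ ⟨hk, hgk⟩
      obtain ⟨k, -, rfl⟩ := mem_image.1 (mem_coe.1 hk)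
      exact mem_coe.2 (mem_image_of_mem f (by simpa using hgk))
    rw [Nat.card_coe_set_eq]
    refine (Set.ncard_le_ncard hsub (finite_toSet _)).trans_lt ?_
    rw [Set.ncard_coe_finset]
    refine card_image_le.trans_lt (lt_of_eq_of_lt ?_ (hf g))
    congr!

/-- The union bound holds over an alphabet of size `2 ^ b` once `n` is large. -/
lemma union_bound_lt {b L n : ℕ} {ρ ε : ℝ} (hρ : 0 < ρ) (hbε : 3 / 2 ≤ b * ε) (hL : 6 ≤ L * ε)
    (hn : (2 * (L : ℝ)) ^ L < (2 : ℝ) ^ n) (hb : 1 ≤ b) :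
    (((2 ^ b : ℕ) : ℝ)) ^ n * ((L * ⌈((2 ^ b : ℕ) : ℝ) ^ (ρ * n)⌉₊ : ℕ) *
      (2 ^ n * ((2 ^ b : ℕ) : ℝ) ^ ((1 - ρ - ε) * n))) ^ L < (((2 ^ b : ℕ) : ℝ) ^ n) ^ L := by
  have hpow : ∀ x : ℝ, ((2 ^ b : ℕ) : ℝ) ^ x = (2 : ℝ) ^ (b * x) := fun x => by
    rw [Nat.cast_pow, Nat.cast_ofNat, ← Real.rpow_natCast, ← Real.rpow_mul zero_le_two]
  have hx : (1 : ℝ) ≤ ((2 ^ b : ℕ) : ℝ) ^ (ρ * n) :=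
    Real.one_le_rpow (by exact_mod_cast Nat.one_le_two_pow) (by positivity)
  have hceil : (⌈((2 ^ b : ℕ) : ℝ) ^ (ρ * n)⌉₊ : ℝ) ≤ 2 * ((2 ^ b : ℕ) : ℝ) ^ (ρ * n) := by
    linarith [Nat.ceil_lt_add_one (zero_le_one.trans hx)]
  have hbn : (2 : ℝ) ^ n ≤ 2 ^ ((b : ℝ) * n) := by
    rw [← Real.rpow_natCast]
    refine Real.rpow_le_rpow_of_exponent_le one_le_two ?_
    have : (1 : ℝ) ≤ b := by exact_mod_cast hb
    nlinarith [(Nat.cast_nonneg n : (0 : ℝ) ≤ n)]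
  calc _ ≤ ((2 ^ b : ℕ) : ℝ) ^ n * (L * (2 * ((2 ^ b : ℕ) : ℝ) ^ (ρ * n)) *
        (2 ^ n * ((2 ^ b : ℕ) : ℝ) ^ ((1 - ρ - ε) * n))) ^ L := by
        rw [Nat.cast_mul]
        gcongr
    _ = (2 * (L : ℝ)) ^ L * 2 ^ (b * n + L * (n + b * (1 - ε) * n) : ℝ) := by
        have e : (L * (2 * ((2 ^ b : ℕ) : ℝ) ^ (ρ * n)) *
            (2 ^ n * ((2 ^ b : ℕ) : ℝ) ^ ((1 - ρ - ε) * n))) =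
            (2 * L) * (2 : ℝ) ^ (n + b * (1 - ε) * n : ℝ) := by
          have : (n + b * (1 - ε) * n : ℝ) = b * (ρ * n) + n + b * ((1 - ρ - ε) * n) := by ring
          rw [this, Real.rpow_add two_pos, Real.rpow_add two_pos, hpow, hpow, Real.rpow_natCast]
          ring
        rw [e, mul_pow _ (_ ^ _), Real.rpow_add two_pos (b * n), mul_comm (L : ℝ) (_ + _),
          Real.rpow_mul zero_le_two _ (L : ℝ), Real.rpow_natCast _ L, ← hpow, Real.rpow_natCast]
        ring
    _ < 2 ^ ((b : ℝ) * n) * 2 ^ (b * n + L * (n + b * (1 - ε) * n) : ℝ) := by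
        gcongr
        exact hn.trans_le hbn
    _ = 2 ^ (b * n + (b * n + L * (n + b * (1 - ε) * n)) : ℝ) := by
        rw [← Real.rpow_add two_pos]
    _ ≤ 2 ^ (b * n * L : ℝ) := by
        refine Real.rpow_le_rpow_of_exponent_le one_le_two ?_
        have hgain : 2 * (b : ℝ) + L ≤ L * (b * ε) := by
          have h1 : 0 ≤ (b : ℝ) * (L * ε - 6) := mul_nonneg (Nat.cast_nonneg _) (by linarith)
          have h2 : 0 ≤ (L : ℝ) * (b * ε - 3 / 2) := mul_nonneg (Nat.cast_nonneg _) (by linarith)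
          nlinarith
        have := mul_nonneg (Nat.cast_nonneg n : (0 : ℝ) ≤ n) (sub_nonneg.2 hgain)
        nlinarith
    _ = _ := by
        rw [Real.rpow_mul zero_le_two, Real.rpow_natCast _ L, ← hpow, Real.rpow_natCast]

/-- The alphabet size `2 ^ ⌈3 / (2 * ε)⌉` is within the doubly exponential budget. -/
lemma ceil_le_two_rpow {ε : ℝ} (hε : ε ∈ Set.Ioo (0 : ℝ) 1) :
    (⌈3 / (2 * ε)⌉₊ : ℝ) ≤ (2 : ℝ) ^ ((1 / ε) ^ (7 : ℝ)) := by
  obtain ⟨h0, h1⟩ := hε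
  have hinv : 1 ≤ 1 / ε := (one_le_div h0).2 h1.le
  rw [show (7 : ℝ) = (7 : ℕ) by norm_num, Real.rpow_natCast]
  rcases le_or_gt (3 / 4) ε with h | h
  · have : ⌈3 / (2 * ε)⌉₊ ≤ 2 := Nat.ceil_le.2 (by
      rw [div_le_iff₀ (by positivity)]
      push_cast
      linarith)
    calc (⌈3 / (2 * ε)⌉₊ : ℝ) ≤ 2 := by exact_mod_cast this
      _ = (2 : ℝ) ^ (1 : ℝ) := (Real.rpow_one 2).symm
      _ ≤ _ := Real.rpow_le_rpow_of_exponent_le one_le_two (one_le_pow₀ hinv)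
  · have h43 : 4 / 3 ≤ 1 / ε := by
      rw [le_div_iff₀ h0]
      linarith
    have h6 : (4 / 3 : ℝ) ^ 6 ≤ (1 / ε) ^ 6 := by gcongr
    have hlow : 3 * (1 / ε) ≤ (1 / ε) ^ 7 := by
      rw [pow_succ]
      gcongr
      exact le_trans (by norm_num) h6
    have hceil := Nat.ceil_lt_add_one (show 0 ≤ 3 / (2 * ε) by positivity)
    rw [show 3 / (2 * ε) = 3 / 2 * (1 / ε) by field_simp] at hceil ⊢
    have hself : (1 / ε) ^ 7 ≤ (2 : ℝ) ^ ((1 / ε) ^ 7) := by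
      have hx : (0 : ℝ) ≤ (1 / ε) ^ 7 := by positivity
      have := one_add_mul_self_le_rpow_one_add (s := 1) (by norm_num)
        (p := (1 / ε) ^ 7) (one_le_pow₀ hinv)
      norm_num at this ⊢
      linarith
    linarith

/-- There is an absolute constant `A > 0` such that for every
`ρ, ε ∈ (0,1)` there is an alphabet of size at most `2^(2^((1/ε)^A))`, and infinitely
many lengths `n` carrying a code of rate at least `ρ` whose list at radius `1−ρ−ε`
around any center has size at most `A/ε`. -/
theorem explicit_list_decoding_capacity :
    ∃ A : ℝ, 0 < A ∧
      ∀ ρ ε : ℝ, ρ ∈ Set.Ioo (0 : ℝ) 1 → ε ∈ Set.Ioo (0 : ℝ) 1 →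
        ∃ M : ℕ, 2 ≤ M ∧
          ((M : ℝ) ≤ (2 : ℝ) ^ ((2 : ℝ) ^ ((1 / ε) ^ A))) ∧
          {n : ℕ |
            ∃ C : Set (Fin n → Fin M),
              -- rate at least `ρ`: `|C| ≥ |Σ|^(ρ·n)`
              (M : ℝ) ^ (ρ * (n : ℝ)) ≤ (Nat.card C : ℝ) ∧
              -- list-size bound at radius `1 − ρ − ε`
              ∀ g : Fin n → Fin M,
                (Nat.card {h : Fin n → Fin M | h ∈ C ∧ hamFrac g h ≤ 1 - ρ - ε} : ℝ)
                  ≤ A / ε}.Infinite := by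
  refine ⟨7, by norm_num, fun ρ ε hρ hε => ?_⟩
  have h0 : 0 < ε := hε.1
  set b := ⌈3 / (2 * ε)⌉₊
  set L := ⌈6 / ε⌉₊
  have hbε : 3 / 2 ≤ (b : ℝ) * ε := by
    have : 3 / (2 * ε) ≤ (b : ℝ) := Nat.le_ceil _
    rw [div_le_iff₀ (by positivity)] at this
    linarith
  have hLε : 6 ≤ (L : ℝ) * ε := (div_le_iff₀ h0).1 (Nat.le_ceil _)
  have hLA : (L : ℝ) ≤ 7 / ε := by
    have h1 := Nat.ceil_lt_add_one (show 0 ≤ 6 / ε by positivity)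
    have h2 : 1 ≤ 1 / ε := (one_le_div h0).2 hε.2.le
    have h3 : 7 / ε = 6 / ε + 1 / ε := by ring
    linarith
  have hb : 1 ≤ b := Nat.one_le_ceil_iff.2 (by positivity)
  have hM : 2 ≤ 2 ^ b := Nat.le_self_pow (by omega) 2
  refine ⟨2 ^ b, hM, ?_, ?_⟩
  · rw [Nat.cast_pow, Nat.cast_ofNat, ← Real.rpow_natCast]
    exact Real.rpow_le_rpow_of_exponent_le one_le_two (ceil_le_two_rpow hε)
  obtain ⟨n₀, hn₀⟩ := pow_unbounded_of_one_lt ((2 * (L : ℝ)) ^ L) one_lt_two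
  refine Set.infinite_of_forall_exists_gt fun m => ⟨max n₀ (m + 1), ?_, by simp⟩
  set n := max n₀ (m + 1)
  have hn : 0 < n := by simp [n]
  rcases lt_or_ge (1 - ρ - ε) 0 with hp | hp
  · refine ⟨Set.univ, ?_, fun g => ?_⟩
    · rw [Nat.card_coe_set_eq, Set.ncard_univ, Nat.card_fun, Nat.card_fin, Nat.card_fin,
        Nat.cast_pow (2 ^ b) n, ← Real.rpow_natCast _ n]
      refine Real.rpow_le_rpow_of_exponent_le (by exact_mod_cast one_le_two.trans hM) ?_
      exact mul_le_of_le_one_left (Nat.cast_nonneg _) hρ.2.le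
    · have : {h : Fin n → Fin (2 ^ b) | h ∈ Set.univ ∧ hamFrac g h ≤ 1 - ρ - ε} = ∅ :=
        Set.eq_empty_of_forall_notMem fun h hh =>
          (hh.2.trans_lt hp).not_ge (hamFrac_nonneg g h)
      rw [Nat.card_coe_set_eq, this, Set.ncard_empty, Nat.cast_zero]
      positivity
  · obtain ⟨C, hC, hlist⟩ := exists_code_card_list_lt hn (one_le_two.trans hM) hp
      (union_bound_lt hρ.1 hbε hLε (hn₀.trans_le (by
        gcongr
        · exact one_le_two
        · exact le_max_left _ _)) hb)
    exact ⟨C, hC, fun g => (Nat.cast_le.2 (hlist g).le).trans hLA⟩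
end
end

section
/- In the AEL setup, assume the inner code C_in has minimum fractional Hamming distance at least δ_in, the outer code C_out has minimum fractional Hamming distance at least δ_out > 0, and G has the (n,d,λ)-mixing property. Then for all distinct f,g ∈ C_AEL: Δ_L(f,g) ≥ δ_out > 0, and Δ_R(f,g) ≥ δ_in − λ/Δ_L(f,g) ≥ δ_in − λ/δ_out. -/
open Finset
open scoped Classical

noncomputable section

/-- Left local projection of an edge-labeling: the `d` symbols on edges incident to `ℓ`. -/
def localL {Sin : Type*} {n d : ℕ} (f : Fin n × Fin d → Sin) (ℓ : Fin n) : Fin d → Sin :=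
  fun i => f (ℓ, i)

/-- Right local projection of an edge-labeling, via the right identification `eR`. -/
def localR {Sin : Type*} {n d : ℕ} (eR : Fin n × Fin d ≃ Fin n × Fin d)
    (f : Fin n × Fin d → Sin) (r : Fin n) : Fin d → Sin :=
  fun j => f (eR.symm (r, j))

/-- Left distance: the fraction of left vertices on which the local projections differ. -/
def DeltaL {Sin : Type*} {n d : ℕ} (f g : Fin n × Fin d → Sin) : ℝ :=
  ((Finset.univ.filter fun ℓ : Fin n => localL f ℓ ≠ localL g ℓ).card : ℝ) / n

/-- Right distance: the fraction of right vertices on which the local projections differ. -/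
def DeltaR {Sin : Type*} {n d : ℕ} (eR : Fin n × Fin d ≃ Fin n × Fin d)
    (f g : Fin n × Fin d → Sin) : ℝ :=
  ((Finset.univ.filter fun r : Fin n => localR eR f r ≠ localR eR g r).card : ℝ) / n

/-- The number of edges whose left endpoint lies in `S` and which satisfy `P` is at least `a` times
the size of `S` when every vertex of `S` is incident to at least `a` edges satisfying `P`. -/
theorem mul_card_le_card_edges {n d : ℕ} (S : Finset (Fin n)) (P : Fin n × Fin d → Prop)
    [DecidablePred P] (a : ℝ)
    (h : ∀ ℓ ∈ S, a ≤ ((Finset.univ.filter fun i : Fin d => P (ℓ, i)).card : ℝ)) :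
    a * S.card ≤ ((Finset.univ.filter fun e : Fin n × Fin d => e.1 ∈ S ∧ P e).card : ℝ) := by
  have hcard : (Finset.univ.filter fun e : Fin n × Fin d => e.1 ∈ S ∧ P e).card
      = ∑ ℓ ∈ S, (Finset.univ.filter fun i : Fin d => P (ℓ, i)).card := by
    rw [← Finset.card_sigma]
    refine Finset.card_bij' (fun e _ => ⟨e.1, e.2⟩) (fun x _ => (x.1, x.2)) ?_ ?_ ?_ ?_ <;> simp
  rw [hcard, Nat.cast_sum, mul_comm, ← nsmul_eq_mul]
  exact Finset.card_nsmul_le_sum S _ a h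

/-- Two labelings that differ on an edge have different local projections at its right endpoint. -/
theorem localR_ne_of_apply_ne {Sin : Type*} {n d : ℕ} (eR : Fin n × Fin d ≃ Fin n × Fin d)
    {f g : Fin n × Fin d → Sin} {e : Fin n × Fin d} (h : f e ≠ g e) :
    localR eR f (eR e).1 ≠ localR eR g (eR e).1 := by
  intro heq
  apply h
  simpa [localR] using congrFun heq (eR e).2

/-- AEL distance amplification.  If the inner code has distance at least
`δ_in`, the outer code has distance at least `δ_out > 0`, and the graph has the
`(n,d,λ)`-mixing property, then any two distinct AEL codewords satisfy
`Δ_L(f,g) ≥ δ_out > 0` and `Δ_R(f,g) ≥ δ_in − λ/Δ_L(f,g) ≥ δ_in − λ/δ_out`. -/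
theorem ael_distance
    {Sin Sout : Type*} [Fintype Sin] [Fintype Sout]
    (n d : ℕ) (hn : 0 < n) (hd : 0 < d)
    (δin δout lam : ℝ) (hδout : 0 < δout)
    (eR : Fin n × Fin d ≃ Fin n × Fin d)
    (Cin : Set (Fin d → Sin)) (Cout : Set (Fin n → Sout))
    (φ : Sout → (Fin d → Sin)) (hφinj : Function.Injective φ)
    (hφrange : Set.range φ = Cin)
    -- the inner code has minimum fractional distance at least `δin`
    (hCin : ∀ c ∈ Cin, ∀ c' ∈ Cin, c ≠ c' →
      δin ≤ ((Finset.univ.filter fun i : Fin d => c i ≠ c' i).card : ℝ) / d)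
    -- the outer code has minimum fractional distance at least `δout`
    (hCout : ∀ w ∈ Cout, ∀ w' ∈ Cout, w ≠ w' →
      δout ≤ ((Finset.univ.filter fun ℓ : Fin n => w ℓ ≠ w' ℓ).card : ℝ) / n)
    -- `G` has the `(n,d,λ)`-mixing property
    (hmix : ∀ S T : Finset (Fin n),
      |((Finset.univ.filter fun e : Fin n × Fin d => e.1 ∈ S ∧ (eR e).1 ∈ T).card : ℝ)
        - ((d : ℝ) / n) * S.card * T.card| ≤ lam * d * n) :
    ∀ f ∈ {f : Fin n × Fin d → Sin | ∃ w ∈ Cout, ∀ ℓ : Fin n, localL f ℓ = φ (w ℓ)},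
    ∀ g ∈ {f : Fin n × Fin d → Sin | ∃ w ∈ Cout, ∀ ℓ : Fin n, localL f ℓ = φ (w ℓ)},
      f ≠ g →
        δout ≤ DeltaL f g ∧ 0 < DeltaL f g ∧
        δin - lam / DeltaL f g ≤ DeltaR eR f g ∧
        δin - lam / δout ≤ δin - lam / DeltaL f g := by
  rintro f ⟨w, hw, hfw⟩ g ⟨w', hw', hgw⟩ hfg
  have hn' : (0 : ℝ) < n := Nat.cast_pos.mpr hn
  have hd' : (0 : ℝ) < d := Nat.cast_pos.mpr hd
  have hlam : 0 ≤ lam := by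
    have h := (abs_nonneg _).trans (hmix ∅ ∅)
    rw [mul_assoc] at h
    exact nonneg_of_mul_nonneg_left h (by positivity)
  have hww : w ≠ w' := by
    rintro rfl
    exact hfg (funext fun e => congrFun ((hfw e.1).trans (hgw e.1).symm) e.2)
  have hout : δout ≤ DeltaL f g := by
    simpa [DeltaL, hfw, hgw, hφinj.eq_iff] using hCout w hw w' hw' hww
  have hpos : 0 < DeltaL f g := hδout.trans_le hout
  refine ⟨hout, hpos, ?_, by gcongr⟩
  set S := Finset.univ.filter fun ℓ : Fin n => localL f ℓ ≠ localL g ℓ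
  set T := Finset.univ.filter fun r : Fin n => localR eR f r ≠ localR eR g r
  have hLS : DeltaL f g = (S.card : ℝ) / n := rfl
  have hRT : DeltaR eR f g = (T.card : ℝ) / n := rfl
  have hinner : ∀ ℓ ∈ S,
      δin * d ≤ ((Finset.univ.filter fun i : Fin d => f (ℓ, i) ≠ g (ℓ, i)).card : ℝ) := by
    intro ℓ hℓ
    refine (le_div_iff₀ hd').mp (hCin (localL f ℓ) ?_ (localL g ℓ) ?_ (Finset.mem_filter.mp hℓ).2)
    · exact hφrange ▸ ⟨w ℓ, (hfw ℓ).symm⟩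
    · exact hφrange ▸ ⟨w' ℓ, (hgw ℓ).symm⟩
  have hlower := mul_card_le_card_edges S (fun e => f e ≠ g e) (δin * d) hinner
  have hsub : ((Finset.univ.filter fun e : Fin n × Fin d => e.1 ∈ S ∧ f e ≠ g e).card : ℝ)
      ≤ ((Finset.univ.filter fun e : Fin n × Fin d => e.1 ∈ S ∧ (eR e).1 ∈ T).card : ℝ) := by
    refine Nat.cast_le.mpr (Finset.card_le_card ?_)
    refine Finset.monotone_filter_right _ fun e _ he => ⟨he.1, ?_⟩
    exact Finset.mem_filter.mpr ⟨Finset.mem_univ _, localR_ne_of_apply_ne eR he.2⟩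
  have hupper := (abs_le.mp (hmix S T)).2
  have hcount : δin * d * S.card ≤ (d : ℝ) / n * S.card * T.card + lam * d * n := by linarith
  have hs : (0 : ℝ) < S.card := (div_pos_iff_of_pos_right hn').mp (hLS ▸ hpos)
  rw [hLS, hRT, sub_le_iff_le_add]
  refine le_of_mul_le_mul_right ?_ (mul_pos hd' hs)
  calc δin * (d * S.card) = δin * d * S.card := by ring
    _ ≤ (d : ℝ) / n * S.card * T.card + lam * d * n := hcount
    _ = ((T.card : ℝ) / n + lam / (S.card / n)) * (d * S.card) := by
      field_simp
end
end

section
/- In the AEL setup, assume the outer code C_out has minimum fractional Hamming distance at least δ_out. Let H ⊆ C_AEL with |H| = k ≥ 2. Then there exist a partition τ* of H with at least 2 nonempty parts and a set L* ⊆ L with |L*| ≥ δ_out·n/k^k such that every ℓ ∈ L* induces τ* (i.e., τ_ℓ = τ*). -/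
open Finset
open scoped Classical

noncomputable section

/-- A map `f : α → β` and the idempotent self-map of `α` sending each point to a chosen
representative of its `f`-fibre have the same kernel. -/
theorem Setoid.ker_invFun_comp_self {α β : Type*} [Nonempty α] (f : α → β) :
    Setoid.ker (Function.invFun f ∘ f) = Setoid.ker f := by
  ext a b
  simp only [Setoid.ker_def, Function.comp_apply]
  refine ⟨fun h => ?_, fun h => by rw [h]⟩
  have key (x : α) : f (Function.invFun f (f x)) = f x := Function.invFun_eq ⟨x, rfl⟩
  rw [← key a, h, key b]

/-- Among finitely many maps out of a finite type `α`, at least a `|α| ^ |α|`-th fraction share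
a common kernel. -/
theorem exists_common_ker {ι α β : Type*} [Fintype α] [Nonempty α] (F : ι → α → β)
    {D : Finset ι} (hD : D.Nonempty) :
    ∃ i₀ ∈ D, ∃ L : Finset ι, D.card ≤ Fintype.card α ^ Fintype.card α * L.card ∧
      ∀ i ∈ L, Setoid.ker (F i) = Setoid.ker (F i₀) := by
  let r : ι → α → α := fun i => Function.invFun (F i) ∘ F i
  have hr : ∀ i, Setoid.ker (r i) = Setoid.ker (F i) := fun i => Setoid.ker_invFun_comp_self (F i)
  obtain ⟨y, hy⟩ : ∃ y : α → α,
      D.card ≤ Fintype.card α ^ Fintype.card α * (D.filter fun i => r i = y).card := by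
    by_contra! h
    have hsum := Finset.card_eq_sum_card_fiberwise (f := r) (s := D) (t := Finset.univ)
      (fun _ _ => Finset.mem_coe.2 (Finset.mem_univ _))
    have hlt := Finset.sum_lt_sum_of_nonempty
      (Finset.univ_nonempty (α := α → α)) (fun y _ => h y)
    rw [← Finset.mul_sum, ← hsum, Finset.sum_const, Finset.card_univ, smul_eq_mul,
      Fintype.card_fun] at hlt
    exact lt_irrefl _ hlt
  obtain ⟨i₀, hi₀⟩ : (D.filter fun i => r i = y).Nonempty := by
    rw [← Finset.card_pos]
    exact Nat.pos_of_mul_pos_left (hD.card_pos.trans_le hy)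
  rw [Finset.mem_filter] at hi₀
  refine ⟨i₀, hi₀.1, _, hy, fun i hi => ?_⟩
  rw [← hr i, ← hr i₀, (Finset.mem_filter.1 hi).2, hi₀.2]

/-- Every setoid on `α` induces a partition of a finset whose parts are its classes, with at
least two parts as soon as two elements of the finset are inequivalent. -/
theorem exists_finpartition_of_setoid {α : Type*} [DecidableEq α] (s : Setoid α) (H : Finset α)
    {a b : α} (ha : a ∈ H) (hb : b ∈ H) (hab : ¬ s a b) :
    ∃ τ : Finpartition H, 2 ≤ τ.parts.card ∧
      ∀ x ∈ H, ∀ y ∈ H, (s x y ↔ ∃ P ∈ τ.parts, x ∈ P ∧ y ∈ P) := by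
  have hrel (x : α) (hx : x ∈ H) (y : α) (hy : y ∈ H) :
      s x y ↔ ∃ P ∈ (Finpartition.ofSetSetoid s H).parts, x ∈ P ∧ y ∈ P := by
    rw [← Finpartition.mem_part_iff_exists, Finpartition.mem_part_ofSetSetoid_iff_rel]
    simpa [hx, hy] using s.comm'
  refine ⟨Finpartition.ofSetSetoid s H, ?_, hrel⟩
  refine Finset.one_lt_card.2 ⟨_, Finpartition.part_mem _ |>.2 ha, _,
    Finpartition.part_mem _ |>.2 hb, fun heq => hab ?_⟩
  exact (hrel a ha b hb).2 ⟨_, Finpartition.part_mem _ |>.2 ha, Finpartition.mem_part _ ha,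
    heq ▸ Finpartition.mem_part _ hb⟩

/-- If the outer code has distance at least `δ_out` and `H ⊆ C_AEL` has
`|H| = k ≥ 2`, then there are a partition `τ*` of `H` with at least two nonempty parts
and a set `L* ⊆ L` with `|L*| ≥ δ_out·n/k^k` such that every `ℓ ∈ L*` induces `τ*`,
i.e. for all `h, h' ∈ H`, `h_ℓ = h'_ℓ` iff `h` and `h'` lie in the same part of `τ*`. -/
theorem ael_common_nontrivial_partition
    {Sin Sout : Type*} [Fintype Sin] [Fintype Sout]
    (n d k : ℕ) (hn : 0 < n) (hd : 0 < d) (hk : 2 ≤ k)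
    (δout : ℝ)
    (eR : Fin n × Fin d ≃ Fin n × Fin d)
    (Cin : Set (Fin d → Sin)) (Cout : Set (Fin n → Sout))
    (φ : Sout → (Fin d → Sin)) (hφinj : Function.Injective φ)
    (hφrange : Set.range φ = Cin)
    -- the outer code has minimum fractional distance at least `δout`
    (hCout : ∀ w ∈ Cout, ∀ w' ∈ Cout, w ≠ w' →
      δout ≤ ((Finset.univ.filter fun ℓ : Fin n => w ℓ ≠ w' ℓ).card : ℝ) / n)
    (H : Finset (Fin n × Fin d → Sin))
    (hH : ↑H ⊆ {f : Fin n × Fin d → Sin | ∃ w ∈ Cout, ∀ ℓ : Fin n, localL f ℓ = φ (w ℓ)})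
    (hcard : H.card = k) :
    ∃ τ : Finpartition H, 2 ≤ τ.parts.card ∧
      ∃ Lstar : Finset (Fin n), δout * n / (k : ℝ) ^ k ≤ Lstar.card ∧
        ∀ ℓ ∈ Lstar, ∀ h ∈ H, ∀ h' ∈ H,
          (localL h ℓ = localL h' ℓ ↔ ∃ P ∈ τ.parts, h ∈ P ∧ h' ∈ P) := by
  obtain ⟨a, ha, b, hb, hab⟩ := Finset.one_lt_card.1 (hk.trans_eq hcard.symm)
  obtain ⟨w, hw, haw⟩ := hH ha
  obtain ⟨w', hw', hbw⟩ := hH hb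
  have hww : w ≠ w' := by
    rintro rfl
    exact hab (funext fun e => congrFun ((haw e.1).trans (hbw e.1).symm) e.2)
  set D := Finset.univ.filter fun ℓ : Fin n => w ℓ ≠ w' ℓ
  have hδ : δout * n ≤ D.card :=
    (le_div_iff₀ (Nat.cast_pos.2 hn)).1 (hCout w hw w' hw' hww)
  obtain hD | hD := D.eq_empty_or_nonempty
  · obtain ⟨τ, hτ, -⟩ := exists_finpartition_of_setoid ⊥ H ha hb hab
    refine ⟨τ, hτ, ∅, ?_, by simp⟩
    rw [hD] at hδ
    simpa using div_nonpos_of_nonpos_of_nonneg (by simpa using hδ) (by positivity)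
  · have : Nonempty H := ⟨⟨a, ha⟩⟩
    obtain ⟨ℓ₀, hℓ₀, L, hL, hker⟩ := exists_common_ker (fun ℓ (h : H) => localL h.1 ℓ) hD
    have hne : ¬ Setoid.ker (localL · ℓ₀) a b := by
      rw [Setoid.ker_def, haw, hbw, hφinj.eq_iff]
      exact (Finset.mem_filter.1 hℓ₀).2
    obtain ⟨τ, hτ, hrel⟩ := exists_finpartition_of_setoid _ H ha hb hne
    refine ⟨τ, hτ, L, ?_, fun ℓ hℓ h hh h' hh' => ?_⟩
    · rw [Fintype.card_coe, hcard] at hL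
      refine div_le_of_le_mul₀ (by positivity) (by positivity) (hδ.trans ?_)
      rw [mul_comm]
      exact_mod_cast hL
    · rw [← hrel h hh h' hh']
      exact Setoid.ext_iff.1 (hker ℓ hℓ) ⟨h, hh⟩ ⟨h', hh'⟩
end
end

section
/- Let Ẽ be a k-tuple of pseudocodewords of degree t ≥ 2kd, and suppose the normalized biadjacency matrix of G satisfies the second-singular-value bound λ. For each ℓ∈L let X_ℓ be a real-valued function of the coordinates Z_{[k]×N(ℓ)} and for each r∈R let Y_r be a real-valued function of the coordinates Z_{[k]×N(r)} (each represented as a polynomial as in the SoS setup). Then |Ẽ[E_{(ℓ,r)∈E}[X_ℓ(Z)·Y_r(Z)]] − Ẽ[E_{ℓ∈L, r∈R}[X_ℓ(Z)·Y_r(Z)]]| ≤ λ · sqrt(Ẽ[E_{ℓ∈L} X_ℓ(Z)²]) · sqrt(Ẽ[E_{r∈R} Y_r(Z)²]), where E_{(ℓ,r)∈E} is the average over a uniformly random edge and E_{ℓ∈L, r∈R} over independent uniform ℓ and r. -/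
open Finset MvPolynomial
open scoped Classical

noncomputable section

/-- The SoS variables `Z_{i,e,σ}`: one for each row `i ∈ [k]`, edge `e` (an edge of the
AEL graph, identified with a pair in `L × [d]`) and symbol `σ ∈ Σ_in`. -/
abbrev SoSVar (k n d : ℕ) (A : Type*) : Type _ := Fin k × (Fin n × Fin d) × A

variable {A : Type*} [Fintype A] {k n d : ℕ}

/-- The monomial `Z_{{i}×N(ℓ), a}` selecting local assignment `a` for row `i` at the
left vertex `ℓ`. -/
def ZL (i : Fin k) (ℓ : Fin n) (a : Fin d → A) : MvPolynomial (SoSVar k n d A) ℝ :=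
  ∏ j : Fin d, X (i, (ℓ, j), a j)

/-- The monomial `Z_{{i}×N(r), a}` selecting local assignment `a` for row `i` at the
right vertex `r` (via the right identification `eR` of edges). -/
def ZR (eR : Fin n × Fin d ≃ Fin n × Fin d) (i : Fin k) (r : Fin n) (a : Fin d → A) :
    MvPolynomial (SoSVar k n d A) ℝ :=
  ∏ j : Fin d, X (i, eR.symm (r, j), a j)

/-- A degree-`t` pseudoexpectation: a linear functional with `Ẽ[1]=1`, nonnegative on
squares of degree ≤ t/2, and respecting the Boolean and normalization constraints. -/
def IsPseudoExpectation (PE : MvPolynomial (SoSVar k n d A) ℝ →ₗ[ℝ] ℝ) (t : ℕ) : Prop :=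
  PE 1 = 1 ∧
  (∀ p : MvPolynomial (SoSVar k n d A) ℝ, 2 * p.totalDegree ≤ t → 0 ≤ PE (p ^ 2)) ∧
  (∀ (p : MvPolynomial (SoSVar k n d A) ℝ) (v : SoSVar k n d A),
      p.totalDegree + 2 ≤ t → PE (p * (X v ^ 2 - X v)) = 0) ∧
  (∀ (p : MvPolynomial (SoSVar k n d A) ℝ) (i : Fin k) (e : Fin n × Fin d),
      p.totalDegree + 1 ≤ t → PE (p * ((∑ σ : A, X (i, e, σ)) - 1)) = 0)

/-- A `k`-tuple of pseudocodewords of degree `t`: a degree-`t` pseudoexpectation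
additionally annihilating local assignments outside the inner code. -/
def IsPseudocodeword (Cin : Set (Fin d → A)) (PE : MvPolynomial (SoSVar k n d A) ℝ →ₗ[ℝ] ℝ)
    (t : ℕ) : Prop :=
  IsPseudoExpectation PE t ∧
  ∀ (p : MvPolynomial (SoSVar k n d A) ℝ) (i : Fin k) (ℓ : Fin n) (a : Fin d → A),
    a ∉ Cin → p.totalDegree + d ≤ t → PE (p * ZL i ℓ a) = 0

/-- The pseudo left distance `Ẽ[Δ_L(Z_i, Z_{i'})]`. -/
def pdeltaL (PE : MvPolynomial (SoSVar k n d A) ℝ →ₗ[ℝ] ℝ) (i i' : Fin k) : ℝ :=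
  (∑ ℓ : Fin n, PE (∑ a : Fin d → A, ∑ b : Fin d → A,
      if a ≠ b then ZL i ℓ a * ZL i' ℓ b else 0)) / n

/-- The polynomial `D_{S,r}(g,Z)`: the indicator that `r` is a common error location for
all rows `i ∈ S` with respect to `g`. -/
def Dpoly (eR : Fin n × Fin d ≃ Fin n × Fin d) (g : Fin n × Fin d → A)
    (S : Finset (Fin k)) (r : Fin n) : MvPolynomial (SoSVar k n d A) ℝ :=
  ∏ i ∈ S, ∑ a : Fin d → A,
    if a ≠ (fun j => g (eR.symm (r, j))) then ZR eR i r a else 0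

/-- The pseudo right distance `Ẽ[Δ_R(g, Z_S)]` (common errors of the rows in `S`). -/
def pdeltaR (eR : Fin n × Fin d ≃ Fin n × Fin d)
    (PE : MvPolynomial (SoSVar k n d A) ℝ →ₗ[ℝ] ℝ)
    (g : Fin n × Fin d → A) (S : Finset (Fin k)) : ℝ :=
  (∑ r : Fin n, PE (Dpoly eR g S r)) / n

/-- The monomial `Z_{T,γ}` for a set `T ⊆ [k] × E` and assignment `γ : T → Σ_in`. -/
def ZA (T : Finset (Fin k × (Fin n × Fin d))) (γ : {x // x ∈ T} → A) :
    MvPolynomial (SoSVar k n d A) ℝ :=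
  ∏ x : {x // x ∈ T}, X (x.1.1, x.1.2, γ x)

/-- Pseudocovariance of the coordinate sets `T1, T2` with respect to an operator `F`. -/
def CovF (F : MvPolynomial (SoSVar k n d A) ℝ → ℝ)
    (T1 T2 : Finset (Fin k × (Fin n × Fin d))) : ℝ :=
  ∑ a : {x // x ∈ T1} → A, ∑ b : {x // x ∈ T2} → A,
    |F (ZA T1 a * ZA T2 b) - F (ZA T1 a) * F (ZA T2 b)|

/-- The set `[k] × N(ℓ)` of coordinates. -/
def KNL (k : ℕ) {n : ℕ} (d : ℕ) (ℓ : Fin n) : Finset (Fin k × (Fin n × Fin d)) :=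
  Finset.univ ×ˢ (Finset.univ.image fun j : Fin d => ((ℓ, j) : Fin n × Fin d))

/-- The set `[k] × N(r)` of coordinates. -/
def KNR (k : ℕ) {n d : ℕ} (eR : Fin n × Fin d ≃ Fin n × Fin d) (r : Fin n) :
    Finset (Fin k × (Fin n × Fin d)) :=
  Finset.univ ×ˢ (Finset.univ.image fun j : Fin d => eR.symm (r, j))

/-- `Ẽ` is `η`-good: the average pseudocovariance between the local coordinate sets of a
uniformly random left vertex and a uniformly random right vertex is at most `η`. -/
def EtaGood (eR : Fin n × Fin d ≃ Fin n × Fin d)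
    (PE : MvPolynomial (SoSVar k n d A) ℝ →ₗ[ℝ] ℝ) (η : ℝ) : Prop :=
  (∑ ℓ : Fin n, ∑ r : Fin n, CovF (fun p => PE p) (KNL k d ℓ) (KNR k eR r)) / ((n : ℝ) * n) ≤ η

/-- The second-singular-value bound `λ` for the normalized biadjacency matrix. -/
def SingularBound (eR : Fin n × Fin d ≃ Fin n × Fin d) (lam : ℝ) : Prop :=
  ∀ x : Fin n → ℝ,
    Real.sqrt (∑ ℓ : Fin n,
        ((∑ j : Fin d, x ((eR (ℓ, j)).1)) / d - (∑ r : Fin n, x r) / n) ^ 2)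
      ≤ lam * Real.sqrt (∑ r : Fin n, x r ^ 2)

/-- `i` and `i'` lie in the same part of the partition `τ` of `[k]`. -/
def SamePart (τ : Finpartition (Finset.univ : Finset (Fin k))) (i i' : Fin k) : Prop :=
  ∃ P ∈ τ.parts, i ∈ P ∧ i' ∈ P

/-- The indicator polynomial `Λ_{ℓ,τ}(Z)` of the event that the local assignments at
`ℓ` induce exactly the partition `τ` of `[k]`. -/
def Lam (τ : Finpartition (Finset.univ : Finset (Fin k))) (ℓ : Fin n) :
    MvPolynomial (SoSVar k n d A) ℝ :=
  ∑ a : Fin k → Fin d → A,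
    if ∀ i i' : Fin k, (a i = a i' ↔ SamePart τ i i') then ∏ i : Fin k, ZL i ℓ (a i) else 0

/-- Fraction of erased coordinates of a partially erased word. -/
def eraseFrac {ι B : Type*} [Fintype ι] (g : ι → Option B) : ℝ :=
  ((Finset.univ.filter fun i => g i = none).card : ℝ) / (Fintype.card ι)

/-- Distance of a partially erased word to a word (non-erased disagreements only). -/
def deltaE {ι B : Type*} [Fintype ι] (g : ι → Option B) (h : ι → B) : ℝ :=
  ((Finset.univ.filter fun i => g i ≠ none ∧ g i ≠ some (h i)).card : ℝ) / (Fintype.card ι)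

/-- `(δ, k, ε)` average-radius list decodable with erasures. -/
def ARLDE {ι B : Type*} [Fintype ι] (C : Set (ι → B)) (δ : ℝ) (k : ℕ) (ε : ℝ) : Prop :=
  ∀ g : ι → Option B, ∀ H : Finset (ι → B), ↑H ⊆ C → H.card ≤ k →
    ((H.card : ℝ) - 1) * (δ - eraseFrac g - ε) ≤ ∑ h ∈ H, deltaE g h

/-- The polynomial representing a real-valued function of the coordinates `[k] × N(ℓ)`
(left local view). -/
def XPolyL {A : Type*} [Fintype A] {k n d : ℕ} (ℓ : Fin n)
    (μ : (Fin k → Fin d → A) → ℝ) : MvPolynomial (SoSVar k n d A) ℝ :=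
  ∑ a : Fin k → Fin d → A, MvPolynomial.C (μ a) * ∏ i : Fin k, ZL i ℓ (a i)

/-- The polynomial representing a real-valued function of the coordinates `[k] × N(r)`
(right local view). -/
def YPolyR {A : Type*} [Fintype A] {k n d : ℕ} (eR : Fin n × Fin d ≃ Fin n × Fin d)
    (r : Fin n) (μ : (Fin k → Fin d → A) → ℝ) : MvPolynomial (SoSVar k n d A) ℝ :=
  ∑ a : Fin k → Fin d → A, MvPolynomial.C (μ a) * ∏ i : Fin k, ZR eR i r (a i)

lemma totalDegree_prod_prod_X_le {σ : Type*} (f : Fin k → Fin d → σ) :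
    (∏ i, ∏ j, (X (f i j) : MvPolynomial σ ℝ)).totalDegree ≤ k * d := by
  refine (totalDegree_finsetProd _ _).trans ?_
  have h (i : Fin k) : (∏ j, (X (f i j) : MvPolynomial σ ℝ)).totalDegree ≤ d :=
    (totalDegree_finsetProd _ _).trans (by simp)
  exact (Finset.sum_le_sum fun i _ => h i).trans (by simp)

lemma totalDegree_sum_C_mul_le {σ ι : Type*} [Fintype ι] (c : ι → ℝ)
    (p : ι → MvPolynomial σ ℝ) {m : ℕ} (hp : ∀ i, (p i).totalDegree ≤ m) :
    (∑ i, C (c i) * p i).totalDegree ≤ m := by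
  refine totalDegree_finsetSum_le fun i _ => (totalDegree_mul _ _).trans ?_
  simpa using hp i

lemma totalDegree_XPolyL_le (ℓ : Fin n) (μ : (Fin k → Fin d → A) → ℝ) :
    (XPolyL ℓ μ).totalDegree ≤ k * d :=
  totalDegree_sum_C_mul_le _ _ fun _ => totalDegree_prod_prod_X_le _

lemma totalDegree_YPolyR_le (eR : Fin n × Fin d ≃ Fin n × Fin d) (r : Fin n)
    (μ : (Fin k → Fin d → A) → ℝ) : (YPolyR eR r μ).totalDegree ≤ k * d :=
  totalDegree_sum_C_mul_le _ _ fun _ => totalDegree_prod_prod_X_le _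

open scoped MatrixOrder in
/-- Low-degree polynomials are realized, as far as their pairwise pseudo-moments are concerned,
by real vectors. -/
lemma IsPseudoExpectation.exists_gram {PE : MvPolynomial (SoSVar k n d A) ℝ →ₗ[ℝ] ℝ} {t m : ℕ}
    (hPE : IsPseudoExpectation PE t) (hm : 2 * m ≤ t) {ι : Type*} [Fintype ι]
    (p : ι → MvPolynomial (SoSVar k n d A) ℝ) (hp : ∀ i, (p i).totalDegree ≤ m) :
    ∃ c : Matrix ι ι ℝ, ∀ u v, PE (p u * p v) = ∑ i, c i u * c i v := by
  have hpos : (Matrix.of fun u v => PE (p u * p v)).PosSemidef := by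
    refine Matrix.PosSemidef.of_dotProduct_mulVec_nonneg ?_ fun x => ?_
    · ext u v
      simp [mul_comm]
    · have h : star x ⬝ᵥ (Matrix.of fun u v => PE (p u * p v)).mulVec x
          = PE ((∑ u, C (x u) * p u) ^ 2) := by
        rw [sq, Finset.sum_mul_sum]
        simp only [dotProduct, Matrix.mulVec, Matrix.of_apply, map_sum, Finset.mul_sum,
          star_trivial]
        refine Finset.sum_congr rfl fun u _ => Finset.sum_congr rfl fun v _ => ?_
        rw [show C (x u) * p u * (C (x v) * p v) = x u • x v • (p u * p v) by
          simp only [smul_eq_C_mul]; ring, map_smul, map_smul, smul_eq_mul, smul_eq_mul]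
        ring
      rw [h]
      refine hPE.2.1 _ (le_trans ?_ hm)
      exact Nat.mul_le_mul_left 2 (totalDegree_sum_C_mul_le x p hp)
  obtain ⟨c, hc⟩ := CStarAlgebra.nonneg_iff_eq_star_mul_self.mp hpos.nonneg
  refine ⟨c, fun u v => ?_⟩
  simpa [Matrix.mul_apply] using congrFun (congrFun hc u) v

/-- The expander mixing lemma for real-valued functions on the vertices. -/
lemma SingularBound.abs_mixing_le {eR : Fin n × Fin d ≃ Fin n × Fin d} {lam : ℝ}
    (h : SingularBound eR lam) (x y : Fin n → ℝ) :
    |(∑ e, x e.1 * y (eR e).1) / d - (∑ ℓ, ∑ r, x ℓ * y r) / n|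
      ≤ lam * (√(∑ ℓ, x ℓ ^ 2) * √(∑ r, y r ^ 2)) := by
  have key : (∑ e, x e.1 * y (eR e).1) / d - (∑ ℓ, ∑ r, x ℓ * y r) / n
      = ∑ ℓ, x ℓ * ((∑ j, y (eR (ℓ, j)).1) / d - (∑ r, y r) / n) := by
    rw [Fintype.sum_prod_type]
    simp only [mul_sub, Finset.sum_sub_distrib, ← Finset.mul_sum, Finset.sum_div, mul_div_assoc]
  rw [key]
  calc _ ≤ √(∑ ℓ, x ℓ ^ 2)
        * √(∑ ℓ, ((∑ j, y (eR (ℓ, j)).1) / d - (∑ r, y r) / n) ^ 2) := by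
        rw [← Real.sqrt_mul (by positivity)]
        exact Real.abs_le_sqrt (Finset.sum_mul_sq_le_sq_mul_sq _ _ _)
    _ ≤ √(∑ ℓ, x ℓ ^ 2) * (lam * √(∑ r, y r ^ 2)) := by
        gcongr
        exact h y
    _ = _ := by ring

lemma SingularBound.nonneg {eR : Fin n × Fin d ≃ Fin n × Fin d} {lam : ℝ}
    (h : SingularBound eR lam) (hn : 0 < n) : 0 ≤ lam := by
  have h1 := (Real.sqrt_nonneg _).trans (h fun _ => 1)
  have h2 : 0 < √(∑ _r : Fin n, (1 : ℝ) ^ 2) := by simpa using hn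
  exact nonneg_of_mul_nonneg_left h1 h2

/-- The expander mixing lemma for vector-valued functions on the vertices. -/
lemma SingularBound.abs_sum_mixing_le {eR : Fin n × Fin d ≃ Fin n × Fin d} {lam : ℝ}
    (h : SingularBound eR lam) (hn : 0 < n) {ι : Type*} [Fintype ι] (x y : ι → Fin n → ℝ) :
    |(∑ e, ∑ i, x i e.1 * y i (eR e).1) / d - (∑ ℓ, ∑ r, ∑ i, x i ℓ * y i r) / n|
      ≤ lam * (√(∑ ℓ, ∑ i, x i ℓ ^ 2) * √(∑ r, ∑ i, y i r ^ 2)) := by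
  have key : (∑ e, ∑ i, x i e.1 * y i (eR e).1) / d - (∑ ℓ, ∑ r, ∑ i, x i ℓ * y i r) / n
      = ∑ i, ((∑ e, x i e.1 * y i (eR e).1) / d - (∑ ℓ, ∑ r, x i ℓ * y i r) / n) := by
    rw [Finset.sum_sub_distrib, ← Finset.sum_div, ← Finset.sum_div]
    congr 2
    · exact Finset.sum_comm
    · rw [Finset.sum_comm (s := (Finset.univ : Finset ι))]
      exact Finset.sum_congr rfl fun ℓ _ => Finset.sum_comm
  rw [key, Finset.sum_comm (f := fun ℓ i => x i ℓ ^ 2), Finset.sum_comm (f := fun r i => y i r ^ 2)]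
  refine (Finset.abs_sum_le_sum_abs _ _).trans
    ((Finset.sum_le_sum fun i _ => h.abs_mixing_le (x i) (y i)).trans ?_)
  rw [← Finset.mul_sum]
  exact mul_le_mul_of_nonneg_left (Real.sum_sqrt_mul_sqrt_le _
    (fun _ => by positivity) (fun _ => by positivity)) (h.nonneg hn)

/-- expander mixing lemma for pseudoexpectations. -/
theorem sos_expander_mixing
    {A : Type*} [Fintype A]
    (k n d : ℕ) (hn : 0 < n) (hd : 0 < d)
    (lam : ℝ)
    (eR : Fin n × Fin d ≃ Fin n × Fin d)
    (Cin : Set (Fin d → A))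
    (hsing : SingularBound eR lam)
    (t : ℕ) (ht : 2 * k * d ≤ t)
    (PE : MvPolynomial (SoSVar k n d A) ℝ →ₗ[ℝ] ℝ)
    (hPE : IsPseudocodeword Cin PE t)
    (Xf : Fin n → (Fin k → Fin d → A) → ℝ)
    (Yf : Fin n → (Fin k → Fin d → A) → ℝ) :
    |(∑ e : Fin n × Fin d,
          PE (XPolyL e.1 (Xf e.1) * YPolyR eR (eR e).1 (Yf (eR e).1))) / ((n : ℝ) * d)
        - (∑ ℓ : Fin n, ∑ r : Fin n,
            PE (XPolyL ℓ (Xf ℓ) * YPolyR eR r (Yf r))) / ((n : ℝ) * n)|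
      ≤ lam * Real.sqrt ((∑ ℓ : Fin n, PE (XPolyL ℓ (Xf ℓ) ^ 2)) / n)
          * Real.sqrt ((∑ r : Fin n, PE (YPolyR eR r (Yf r) ^ 2)) / n) := by
  obtain ⟨c, hc⟩ := hPE.1.exists_gram (m := k * d) (by rwa [← mul_assoc])
    (Sum.elim (fun ℓ => XPolyL ℓ (Xf ℓ)) fun r => YPolyR eR r (Yf r))
    (Sum.rec (fun ℓ => totalDegree_XPolyL_le ℓ _) fun r => totalDegree_YPolyR_le eR r _)
  have hXY (ℓ r : Fin n) : PE (XPolyL ℓ (Xf ℓ) * YPolyR eR r (Yf r))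
      = ∑ i, c i (.inl ℓ) * c i (.inr r) := hc (.inl ℓ) (.inr r)
  have hX (ℓ : Fin n) : PE (XPolyL ℓ (Xf ℓ) ^ 2) = ∑ i, c i (.inl ℓ) ^ 2 := by
    simpa only [sq, Sum.elim_inl] using hc (.inl ℓ) (.inl ℓ)
  have hY (r : Fin n) : PE (YPolyR eR r (Yf r) ^ 2) = ∑ i, c i (.inr r) ^ 2 := by
    simpa only [sq, Sum.elim_inr] using hc (.inr r) (.inr r)
  simp only [hXY, hX, hY]
  have hmix := hsing.abs_sum_mixing_le hn (fun i ℓ => c i (.inl ℓ)) fun i r => c i (.inr r)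
  have hn' : (0 : ℝ) < n := Nat.cast_pos.mpr hn
  rw [mul_comm (n : ℝ) d, ← div_div, ← div_div, ← sub_div, abs_div, abs_of_pos hn', mul_assoc,
    Real.sqrt_div (by positivity), Real.sqrt_div (by positivity), div_mul_div_comm,
    Real.mul_self_sqrt hn'.le, mul_div_assoc']
  exact div_le_div_of_nonneg_right hmix hn'.le
end
end

section
/- Let k ≥ 2 and let Ẽ be a k-tuple of pseudocodewords of degree t ≥ 2kd satisfying Ẽ[Δ_L(Z_i, Z_{i'})] ≥ β for all i ≠ i' in [k]. Then there exists a partition τ* of [k] with at least 2 nonempty parts such that Ẽ[E_{ℓ∈L}[Λ_{ℓ,τ*}(Z)]] ≥ β/k^k. -/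
open Finset MvPolynomial
open scoped Classical

noncomputable section

variable {A : Type*} [Fintype A] {k n d : ℕ}

/-- Boolean reduction: squared variables may be replaced by the variables themselves. -/
theorem IsPseudoExpectation.map_prod_sq_mul {t : ℕ}
    {PE : MvPolynomial (SoSVar k n d A) ℝ →ₗ[ℝ] ℝ} (hPE : IsPseudoExpectation PE t)
    {ι : Type*} (s : Finset ι) (f : ι → SoSVar k n d A) (q : MvPolynomial (SoSVar k n d A) ℝ)
    (hq : q.totalDegree + 2 * s.card ≤ t) :
    PE ((∏ x ∈ s, X (f x) ^ 2) * q) = PE ((∏ x ∈ s, X (f x)) * q) := by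
  induction s using Finset.induction_on generalizing q with
  | empty => simp
  | insert v s hv ih =>
    rw [Finset.card_insert_of_notMem hv] at hq
    have hdeg : (∏ x ∈ s, (X (f x) : MvPolynomial (SoSVar k n d A) ℝ) ^ 2).totalDegree
        ≤ 2 * s.card := by
      refine (totalDegree_finsetProd _ _).trans ?_
      refine (Finset.sum_le_card_nsmul _ _ 2 fun x _ => ?_).trans (by simp [mul_comm])
      rw [totalDegree_X_pow]
    have h1 := hPE.2.2.1 ((∏ x ∈ s, X (f x) ^ 2) * q) (f v)
      (by have := totalDegree_mul (∏ x ∈ s, (X (f x) : MvPolynomial (SoSVar k n d A) ℝ) ^ 2) q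
          omega)
    have h2 := ih (X (f v) * q)
      (by have := totalDegree_mul (X (f v) : MvPolynomial (SoSVar k n d A) ℝ) q
          rw [totalDegree_X] at this
          omega)
    rw [mul_sub, map_sub, sub_eq_zero] at h1
    rw [Finset.prod_insert hv, Finset.prod_insert hv]
    calc _ = PE ((∏ x ∈ s, X (f x) ^ 2) * q * X (f v) ^ 2) := by congr 1; ring
      _ = PE ((∏ x ∈ s, X (f x) ^ 2) * (X (f v) * q)) := by rw [h1]; congr 1; ring
      _ = _ := by rw [h2]; congr 1; ring

/-- Monomials have nonnegative pseudoexpectation. -/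
theorem IsPseudoExpectation.map_prod_X_nonneg {t : ℕ}
    {PE : MvPolynomial (SoSVar k n d A) ℝ →ₗ[ℝ] ℝ} (hPE : IsPseudoExpectation PE t)
    {ι : Type*} (s : Finset ι) (f : ι → SoSVar k n d A) (hs : 2 * s.card ≤ t) :
    0 ≤ PE (∏ x ∈ s, X (f x)) := by
  have h := hPE.map_prod_sq_mul s f 1 (by simpa using hs)
  rw [mul_one, mul_one, Finset.prod_pow] at h
  rw [← h]
  refine hPE.2.1 _ (le_trans (Nat.mul_le_mul_left 2 ?_) hs)
  refine (totalDegree_finsetProd _ _).trans ?_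
  exact (Finset.sum_le_card_nsmul _ _ 1 fun x _ => (totalDegree_X _).le).trans (by simp)

/-- Normalization: factors `∑ σ, Z_{i,e,σ}` may be dropped. -/
theorem IsPseudoExpectation.map_mul_prod_sum {t : ℕ}
    {PE : MvPolynomial (SoSVar k n d A) ℝ →ₗ[ℝ] ℝ} (hPE : IsPseudoExpectation PE t)
    (s : Finset (Fin k × (Fin n × Fin d))) (p : MvPolynomial (SoSVar k n d A) ℝ)
    (hp : p.totalDegree + s.card ≤ t) :
    PE (p * ∏ x ∈ s, ∑ σ : A, X (x.1, x.2, σ)) = PE p := by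
  induction s using Finset.induction_on generalizing p with
  | empty => simp
  | insert v s hv ih =>
    rw [Finset.card_insert_of_notMem hv] at hp
    have hsum : (∑ σ : A, (X (v.1, v.2, σ) : MvPolynomial (SoSVar k n d A) ℝ)).totalDegree ≤ 1 :=
      totalDegree_finsetSum_le fun σ _ => (totalDegree_X _).le
    have h1 := hPE.2.2.2 p v.1 v.2 (by omega)
    rw [mul_sub, mul_one, map_sub, sub_eq_zero] at h1
    rw [Finset.prod_insert hv, ← mul_assoc, ih _ ((Nat.add_le_add_right
      (totalDegree_mul _ _) _).trans (by omega)), h1]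

theorem totalDegree_ZL_le {B : Type*} (i : Fin k) (ℓ : Fin n) (a : Fin d → B) :
    (ZL i ℓ a).totalDegree ≤ d := by
  refine (totalDegree_finsetProd _ _).trans ?_
  exact (Finset.sum_le_card_nsmul _ _ 1 fun x _ => (totalDegree_X _).le).trans (by simp)

theorem IsPseudoExpectation.map_prod_ZL_nonneg {t : ℕ}
    {PE : MvPolynomial (SoSVar k n d A) ℝ →ₗ[ℝ] ℝ} (hPE : IsPseudoExpectation PE t)
    (ht : 2 * k * d ≤ t) (ℓ : Fin n) (a : Fin k → Fin d → A) :
    0 ≤ PE (∏ i, ZL i ℓ (a i)) := by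
  have h := hPE.map_prod_X_nonneg (Finset.univ : Finset (Fin k × Fin d))
    (fun x => (x.1, (ℓ, x.2), a x.1 x.2)) (by simpa [mul_assoc] using ht)
  rwa [Fintype.prod_prod_type] at h

/-- The joint pseudodistribution of two rows is a marginal of that of all rows. -/
theorem IsPseudoExpectation.map_ZL_mul_ZL {t : ℕ}
    {PE : MvPolynomial (SoSVar k n d A) ℝ →ₗ[ℝ] ℝ} (hPE : IsPseudoExpectation PE t)
    (ht : k * d ≤ t) (ℓ : Fin n) {i i' : Fin k} (hi : i ≠ i') (a b : Fin d → A) :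
    PE (ZL i ℓ a * ZL i' ℓ b) =
      ∑ c : Fin k → Fin d → A,
        if c i = a ∧ c i' = b then PE (∏ m, ZL m ℓ (c m)) else 0 := by
  let T : Fin k → Finset (Fin d → A) :=
    fun m => if m = i then {a} else if m = i' then {b} else Finset.univ
  have hT : ∀ c : Fin k → Fin d → A, c ∈ Fintype.piFinset T ↔ c i = a ∧ c i' = b := by
    intro c
    rw [Fintype.mem_piFinset]
    constructor
    · intro h
      have h1 := h i
      have h2 := h i'
      simp only [T, if_true, if_neg hi.symm, Finset.mem_singleton] at h1 h2
      exact ⟨h1, h2⟩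
    · rintro ⟨rfl, rfl⟩ m
      by_cases h1 : m = i
      · simp [T, h1]
      · by_cases h2 : m = i'
        · subst h2; simp [T, h1]
        · simp [T, h1, h2]
  let S : Finset (Fin k) := (Finset.univ.erase i).erase i'
  have hS : S.card + 2 = k := by
    have h1 : i' ∈ Finset.univ.erase i := by simp [hi.symm]
    have h2 : S.card + 1 = _ := Finset.card_erase_add_one h1
    have h3 := Finset.card_erase_add_one (Finset.mem_univ i)
    rw [Finset.card_univ, Fintype.card_fin] at h3
    omega
  have hprod : (∏ m, ∑ c ∈ T m, ZL m ℓ c) =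
      ZL i ℓ a * ZL i' ℓ b * ∏ x ∈ S ×ˢ Finset.univ.map ⟨fun j : Fin d => (ℓ, j),
        fun _ _ h => (Prod.ext_iff.1 h).2⟩, ∑ σ : A, X (x.1, x.2, σ) := by
    rw [← Finset.mul_prod_erase Finset.univ _ (Finset.mem_univ i),
      ← Finset.mul_prod_erase (Finset.univ.erase i) _ (by simp [hi.symm] : i' ∈ _),
      ← mul_assoc, Finset.prod_product]
    congr 1
    · simp [T, hi.symm]
    · refine Finset.prod_congr rfl fun m hm => ?_
      simp only [S, Finset.mem_erase] at hm
      simp only [T, if_neg hm.1, if_neg hm.2.1, Finset.prod_map]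
      rw [Finset.prod_univ_sum, Fintype.piFinset_univ]
      rfl
  have hmarg := hPE.map_mul_prod_sum (S ×ˢ Finset.univ.map ⟨fun j : Fin d => (ℓ, j),
        fun _ _ h => (Prod.ext_iff.1 h).2⟩) (ZL i ℓ a * ZL i' ℓ b) (by
    rw [Finset.card_product, Finset.card_map, Finset.card_univ, Fintype.card_fin]
    have h1 := totalDegree_mul (ZL i ℓ a) (ZL i' ℓ b)
    have h2 := totalDegree_ZL_le i ℓ a
    have h3 := totalDegree_ZL_le i' ℓ b
    have h4 : S.card * d + 2 * d = k * d := by rw [← add_mul, hS]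
    omega)
  rw [← hmarg, ← hprod, Finset.prod_univ_sum, map_sum, ← Finset.sum_filter]
  refine Finset.sum_congr ?_ fun _ _ => rfl
  ext c
  simp [hT c]

/-- The left disagreement of two rows is a sum over joint assignments of all rows. -/
theorem IsPseudoExpectation.map_disagree {t : ℕ}
    {PE : MvPolynomial (SoSVar k n d A) ℝ →ₗ[ℝ] ℝ} (hPE : IsPseudoExpectation PE t)
    (ht : k * d ≤ t) (ℓ : Fin n) {i i' : Fin k} (hi : i ≠ i') :
    PE (∑ a : Fin d → A, ∑ b : Fin d → A, if a ≠ b then ZL i ℓ a * ZL i' ℓ b else 0) =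
      ∑ c : Fin k → Fin d → A, if c i ≠ c i' then PE (∏ m, ZL m ℓ (c m)) else 0 := by
  have h : ∀ a b : Fin d → A, PE (if a ≠ b then ZL i ℓ a * ZL i' ℓ b else 0) =
      ∑ c : Fin k → Fin d → A, if c i = a then
        (if c i' = b then (if a ≠ b then PE (∏ m, ZL m ℓ (c m)) else 0) else 0) else 0 := by
    intro a b
    split_ifs with hab
    · simp only [hPE.map_ZL_mul_ZL ht ℓ hi, ite_and]
    · simp
  simp only [map_sum, h]
  rw [Finset.sum_congr rfl fun a _ => Finset.sum_comm, Finset.sum_comm]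
  refine Finset.sum_congr rfl fun c _ => ?_
  rw [Finset.sum_eq_single (c i) (fun a _ ha => by simp [ha.symm]) (by simp),
    Finset.sum_eq_single (c i') (fun b _ hb => by simp [hb.symm]) (by simp)]
  simp

/-- The partition of `[k]` into the fibres of a function. -/
def fiberPartition (c : Fin k → Fin k) : Finpartition (Finset.univ : Finset (Fin k)) :=
  Finpartition.ofSetoid (Setoid.ker c)

theorem samePart_fiberPartition (c : Fin k → Fin k) (i i' : Fin k) :
    SamePart (fiberPartition c) i i' ↔ c i = c i' := by
  have hpart : i' ∈ (fiberPartition c).part i ↔ c i = c i' :=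
    Finpartition.mem_part_ofSetoid_iff_rel
  rw [← hpart]
  constructor
  · rintro ⟨P, hP, h, h'⟩
    rwa [(fiberPartition c).part_eq_of_mem hP h]
  · intro h
    exact ⟨_, (fiberPartition c).part_mem.2 (Finset.mem_univ i),
      (fiberPartition c).mem_part (Finset.mem_univ i), h⟩

theorem two_le_card_parts_fiberPartition {c : Fin k → Fin k} {i i' : Fin k} (h : c i ≠ c i') :
    2 ≤ (fiberPartition c).parts.card := by
  refine Finset.one_lt_card.2 ⟨_, (fiberPartition c).part_mem.2 (Finset.mem_univ i), _,
    (fiberPartition c).part_mem.2 (Finset.mem_univ i'), fun he => h ?_⟩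
  refine (samePart_fiberPartition c i i').1 ⟨_, (fiberPartition c).part_mem.2 (Finset.mem_univ i),
    (fiberPartition c).mem_part (Finset.mem_univ i), ?_⟩
  rw [he]
  exact (fiberPartition c).mem_part (Finset.mem_univ i')

theorem map_Lam (PE : MvPolynomial (SoSVar k n d A) ℝ →ₗ[ℝ] ℝ)
    (τ : Finpartition (Finset.univ : Finset (Fin k))) (ℓ : Fin n) :
    PE (Lam τ ℓ) = ∑ a : Fin k → Fin d → A,
      if ∀ i i' : Fin k, (a i = a i' ↔ SamePart τ i i') then PE (∏ i, ZL i ℓ (a i)) else 0 := by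
  rw [Lam, map_sum]
  refine Finset.sum_congr rfl fun a _ => ?_
  split_ifs <;> simp

theorem IsPseudoExpectation.map_Lam_nonneg {t : ℕ}
    {PE : MvPolynomial (SoSVar k n d A) ℝ →ₗ[ℝ] ℝ} (hPE : IsPseudoExpectation PE t)
    (ht : 2 * k * d ≤ t) (τ : Finpartition (Finset.univ : Finset (Fin k))) (ℓ : Fin n) :
    0 ≤ PE (Lam τ ℓ) := by
  rw [map_Lam]
  refine Finset.sum_nonneg fun a _ => ?_
  split_ifs
  exacts [hPE.map_prod_ZL_nonneg ht ℓ a, le_rfl]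

/-- The disagreement of two rows is covered by the partitions separating them. -/
theorem IsPseudoExpectation.map_disagree_le_sum_Lam {t : ℕ}
    {PE : MvPolynomial (SoSVar k n d A) ℝ →ₗ[ℝ] ℝ} (hPE : IsPseudoExpectation PE t)
    (ht : 2 * k * d ≤ t) (ℓ : Fin n) {i i' : Fin k} (hi : i ≠ i') :
    PE (∑ a : Fin d → A, ∑ b : Fin d → A, if a ≠ b then ZL i ℓ a * ZL i' ℓ b else 0) ≤
      ∑ c : Fin k → Fin k with c i ≠ c i', PE (Lam (fiberPartition c) ℓ) := by
  rw [hPE.map_disagree (by rw [mul_assoc] at ht; omega) ℓ hi]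
  simp only [map_Lam, samePart_fiberPartition]
  rw [Finset.sum_comm]
  refine Finset.sum_le_sum fun a _ => ?_
  have hnonneg : ∀ c : Fin k → Fin k, 0 ≤
      if ∀ m m' : Fin k, (a m = a m' ↔ c m = c m') then PE (∏ m, ZL m ℓ (a m)) else 0 := by
    intro c
    split_ifs
    exacts [hPE.map_prod_ZL_nonneg ht ℓ a, le_rfl]
  split_ifs with ha
  · have : Nonempty (Fin k) := ⟨i⟩
    let c : Fin k → Fin k := fun m => Function.invFun a (a m)
    have hc : ∀ m m' : Fin k, (a m = a m' ↔ c m = c m') := by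
      intro m m'
      refine ⟨fun h => congrArg (Function.invFun a) h, fun h => ?_⟩
      have := congrArg a h
      rwa [Function.invFun_eq (f := a) ⟨m, rfl⟩, Function.invFun_eq (f := a) ⟨m', rfl⟩] at this
    refine le_trans (le_of_eq ?_) (Finset.single_le_sum (fun c _ => hnonneg c)
      (Finset.mem_filter.2 ⟨Finset.mem_univ c, fun h => ha ((hc i i').2 h)⟩))
    rw [if_pos hc]
  · exact Finset.sum_nonneg fun c _ => hnonneg c

/-- A `k`-tuple of pseudocodewords with pairwise-far rows puts mass at
least `β/k^k` on some nontrivial partition of `[k]`. -/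
theorem sos_exists_nontrivial_partition
    {A : Type*} [Fintype A]
    (k n d : ℕ) (hk : 2 ≤ k) (hn : 0 < n) (hd : 0 < d)
    (β : ℝ)
    (Cin : Set (Fin d → A))
    (t : ℕ) (ht : 2 * k * d ≤ t)
    (PE : MvPolynomial (SoSVar k n d A) ℝ →ₗ[ℝ] ℝ)
    (hPE : IsPseudocodeword Cin PE t)
    (hpair : ∀ i i' : Fin k, i ≠ i' → β ≤ pdeltaL PE i i') :
    ∃ τ : Finpartition (Finset.univ : Finset (Fin k)), 2 ≤ τ.parts.card ∧
      β / (k : ℝ) ^ k ≤ (∑ ℓ : Fin n, PE (Lam τ ℓ)) / n := by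
  have hE := hPE.1
  have hn' : (0 : ℝ) < n := by exact_mod_cast hn
  let i : Fin k := ⟨0, by omega⟩
  let i' : Fin k := ⟨1, by omega⟩
  have hi : i ≠ i' := by simp [i, i', Fin.ext_iff]
  let S : Finset (Fin k → Fin k) := {c | c i ≠ c i'}
  have hS : S.Nonempty := ⟨id, by simpa [S] using hi⟩
  suffices h : ∃ c ∈ S, β / (k : ℝ) ^ k ≤ (∑ ℓ : Fin n, PE (Lam (fiberPartition c) ℓ)) / n by
    obtain ⟨c, hc, h⟩ := h
    exact ⟨fiberPartition c, two_le_card_parts_fiberPartition (Finset.mem_filter.1 hc).2, h⟩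
  have hkk : (0 : ℝ) < (k : ℝ) ^ k := by
    have : (0 : ℝ) < k := by exact_mod_cast (by omega : 0 < k)
    positivity
  rcases le_total β 0 with hβ | hβ
  · obtain ⟨c, hc⟩ := hS
    exact ⟨c, hc, (div_nonpos_of_nonpos_of_nonneg hβ hkk.le).trans
      (div_nonneg (Finset.sum_nonneg fun ℓ _ => hE.map_Lam_nonneg ht _ ℓ) hn'.le)⟩
  · refine Finset.exists_le_of_sum_le hS ?_
    have hcard : (S.card : ℝ) ≤ (k : ℝ) ^ k := by
      have h : S.card ≤ k ^ k := (Finset.card_le_univ S).trans (by simp)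
      exact_mod_cast h
    calc ∑ _c ∈ S, β / (k : ℝ) ^ k = S.card * (β / (k : ℝ) ^ k) := by simp
      _ ≤ (k : ℝ) ^ k * (β / (k : ℝ) ^ k) := by gcongr
      _ = β := by field_simp
      _ ≤ pdeltaL PE i i' := hpair i i' hi
      _ ≤ (∑ ℓ : Fin n, ∑ c ∈ S, PE (Lam (fiberPartition c) ℓ)) / n := by
        unfold pdeltaL
        gcongr with ℓ
        exact hE.map_disagree_le_sum_Lam ht ℓ hi
      _ = ∑ c ∈ S, (∑ ℓ : Fin n, PE (Lam (fiberPartition c) ℓ)) / n := by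
        rw [Finset.sum_comm, Finset.sum_div]
end
end

section
/- Assume the normalized biadjacency matrix of G satisfies the second-singular-value bound λ, and let Ẽ be an η-good k-tuple of pseudocodewords of degree t ≥ 4kd with λ ≤ β·ε/(12·k^k) and η ≤ β·ε/(12·k^k). Let τ* = (K_1,…,K_p) be a partition of [k] with at least 2 nonempty parts such that Ẽ[E_{ℓ∈L}[Λ_{ℓ,τ*}(Z)]] ≥ β/k^k, and let g ∈ Σ_in^E. Then for every part K_j of τ*: Ẽ[Δ_R(g, Z_{K_j})] ≥ Ẽ[Δ_R(g, Z_{[k]})] + Ẽ[E_{(ℓ,r)∈E}[Λ_{ℓ,τ*}(Z)·F_{K_j,r}(g,Z)]] / Ẽ[E_{ℓ∈L}[Λ_{ℓ,τ*}(Z)]] − ε/6. -/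
open Finset MvPolynomial
open scoped Classical

noncomputable section

variable {A : Type*} [Fintype A] {k n d : ℕ}

/-- The monomial selecting the assignment `a` on the coordinates `[k] × {e j}`. -/
def blockMonomial (e : Fin d → Fin n × Fin d) (a : Fin k → Fin d → A) :
    MvPolynomial (SoSVar k n d A) ℝ :=
  ∏ i : Fin k, ∏ j : Fin d, X (i, e j, a i j)

/-- The real-valued function `c` of the coordinates `[k] × {e j}`, as a polynomial. -/
def blockPoly (e : Fin d → Fin n × Fin d) (c : (Fin k → Fin d → A) → ℝ) :
    MvPolynomial (SoSVar k n d A) ℝ :=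
  ∑ a, c a • blockMonomial e a

omit [Fintype A] in
lemma totalDegree_blockMonomial_le (e : Fin d → Fin n × Fin d) (a : Fin k → Fin d → A) :
    (blockMonomial e a).totalDegree ≤ k * d := by
  unfold blockMonomial
  refine (totalDegree_finsetProd _ _).trans ?_
  calc ∑ i : Fin k, (∏ j : Fin d, (X (i, e j, a i j) :
          MvPolynomial (SoSVar k n d A) ℝ)).totalDegree
      ≤ ∑ _i : Fin k, d := by
        refine Finset.sum_le_sum fun i _ => (totalDegree_finsetProd _ _).trans ?_
        simp [totalDegree_X]
    _ = k * d := by simp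

lemma totalDegree_blockPoly_le (e : Fin d → Fin n × Fin d) (c : (Fin k → Fin d → A) → ℝ) :
    (blockPoly e c).totalDegree ≤ k * d :=
  totalDegree_finsetSum_le fun a _ =>
    (totalDegree_smul_le _ _).trans (totalDegree_blockMonomial_le e a)

lemma prod_sum_X_eq_sum_prod (e : Fin d → Fin n × Fin d) (i : Fin k) :
    (∏ j : Fin d, ∑ σ : A, X (i, e j, σ) : MvPolynomial (SoSVar k n d A) ℝ)
      = ∑ a : Fin d → A, ∏ j : Fin d, X (i, e j, a j) := by
  rw [Finset.prod_univ_sum, Fintype.piFinset_univ]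

lemma blockPoly_prod (e : Fin d → Fin n × Fin d) (w : Fin k → (Fin d → A) → ℝ) :
    blockPoly e (fun a => ∏ i, w i (a i))
      = ∏ i : Fin k, ∑ a : Fin d → A, w i a • ∏ j : Fin d, X (i, e j, a j) := by
  rw [Finset.prod_univ_sum, Fintype.piFinset_univ]
  refine Finset.sum_congr rfl fun a _ => ?_
  simp only [blockMonomial, smul_eq_C_mul, Finset.prod_mul_distrib, map_prod]

lemma blockPoly_one (e : Fin d → Fin n × Fin d) :
    (blockPoly e (fun _ => 1) : MvPolynomial (SoSVar k n d A) ℝ)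
      = ∏ i : Fin k, ∏ j : Fin d, ∑ σ : A, X (i, e j, σ) := by
  have h := blockPoly_prod (A := A) (k := k) e (fun _ _ => 1)
  simp only [Finset.prod_const_one, one_smul] at h
  simp only [h, prod_sum_X_eq_sum_prod]

section PseudoExpectation

variable {PE : MvPolynomial (SoSVar k n d A) ℝ →ₗ[ℝ] ℝ} {t : ℕ}

lemma IsPseudoExpectation.mul_prod_sum_X (h : IsPseudoExpectation PE t) {ι : Type*}
    (s : Finset ι) (x : ι → Fin k × (Fin n × Fin d)) (q : MvPolynomial (SoSVar k n d A) ℝ)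
    (hq : q.totalDegree + s.card ≤ t) :
    PE (q * ∏ u ∈ s, ∑ σ : A, X ((x u).1, (x u).2, σ)) = PE q := by
  induction s using Finset.induction_on generalizing q with
  | empty => simp
  | insert u s hu ih =>
    rw [Finset.card_insert_of_notMem hu] at hq
    have hS : (∑ σ : A, X ((x u).1, (x u).2, σ) :
        MvPolynomial (SoSVar k n d A) ℝ).totalDegree ≤ 1 :=
      totalDegree_finsetSum_le fun σ _ => (totalDegree_X _).le
    have hd := totalDegree_mul q (∑ σ : A, X ((x u).1, (x u).2, σ))
    rw [Finset.prod_insert hu, ← mul_assoc, ih _ (by omega)]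
    have h0 := h.2.2.2 q (x u).1 (x u).2 (by omega)
    rw [mul_sub, mul_one, map_sub] at h0
    linarith

lemma IsPseudoExpectation.mul_blockPoly_one (h : IsPseudoExpectation PE t)
    (e : Fin d → Fin n × Fin d) (q : MvPolynomial (SoSVar k n d A) ℝ)
    (hq : q.totalDegree + k * d ≤ t) :
    PE (q * blockPoly e (fun _ => 1)) = PE q := by
  rw [blockPoly_one, ← Fintype.prod_prod_type' fun (i : Fin k) (j : Fin d) =>
    (∑ σ : A, X (i, e j, σ) : MvPolynomial (SoSVar k n d A) ℝ)]
  exact h.mul_prod_sum_X Finset.univ (fun u : Fin k × Fin d => (u.1, e u.2)) q (by simpa using hq)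

lemma IsPseudoExpectation.mul_prod_X_sq (h : IsPseudoExpectation PE t) {ι : Type*}
    (s : Finset ι) (v : ι → SoSVar k n d A) (q : MvPolynomial (SoSVar k n d A) ℝ)
    (hq : q.totalDegree + 2 * s.card ≤ t) :
    PE (q * (∏ u ∈ s, X (v u)) ^ 2) = PE (q * ∏ u ∈ s, X (v u)) := by
  induction s using Finset.induction_on generalizing q with
  | empty => simp
  | insert u s hu ih =>
    rw [Finset.card_insert_of_notMem hu] at hq
    have hX : (X (v u) : MvPolynomial (SoSVar k n d A) ℝ).totalDegree = 1 := totalDegree_X _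
    have hX2 := totalDegree_pow (X (v u) : MvPolynomial (SoSVar k n d A) ℝ) 2
    have hd := totalDegree_mul q (X (v u) ^ 2)
    have hP : (∏ u ∈ s, X (v u) : MvPolynomial (SoSVar k n d A) ℝ).totalDegree ≤ s.card := by
      refine (totalDegree_finsetProd _ _).trans ?_
      simp [totalDegree_X]
    have hd' := totalDegree_mul q (∏ u ∈ s, X (v u))
    have h0 := h.2.2.1 (q * ∏ u ∈ s, X (v u)) (v u) (by omega)
    rw [mul_sub, map_sub, sub_eq_zero] at h0
    rw [Finset.prod_insert hu, mul_pow, ← mul_assoc, ih _ (by omega), mul_right_comm, h0]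
    congr 1
    ring

lemma IsPseudoExpectation.blockMonomial_mul_nonneg (h : IsPseudoExpectation PE t)
    (ht : 4 * (k * d) ≤ t) (e : Fin d → Fin n × Fin d) (a b : Fin k → Fin d → A) :
    0 ≤ PE (blockMonomial e a * blockMonomial e b) := by
  have hprod : blockMonomial e a * blockMonomial e b
      = ∏ u : (Fin k × Fin d) ⊕ (Fin k × Fin d),
          X (u.elim (fun p => (p.1, e p.2, a p.1 p.2)) (fun p => (p.1, e p.2, b p.1 p.2)) :
            SoSVar k n d A) := by
    simp only [blockMonomial, Fintype.prod_sum_type, Sum.elim_inl, Sum.elim_inr,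
      Fintype.prod_prod_type]
  have hsq := h.mul_prod_X_sq (Finset.univ : Finset ((Fin k × Fin d) ⊕ (Fin k × Fin d)))
    (fun u => u.elim (fun p => (p.1, e p.2, a p.1 p.2)) (fun p => (p.1, e p.2, b p.1 p.2)))
    1 (by simp; omega)
  rw [← hprod, one_mul, one_mul] at hsq
  rw [← hsq]
  have hd := totalDegree_mul (blockMonomial e a) (blockMonomial e b)
  have ha := totalDegree_blockMonomial_le e a
  have hb := totalDegree_blockMonomial_le e b
  exact h.2.1 _ (by omega)

lemma PE_blockPoly_mul_blockPoly (PE : MvPolynomial (SoSVar k n d A) ℝ →ₗ[ℝ] ℝ)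
    (e e' : Fin d → Fin n × Fin d) (c c' : (Fin k → Fin d → A) → ℝ) :
    PE (blockPoly e c * blockPoly e' c')
      = ∑ a, ∑ b, c a * c' b * PE (blockMonomial e a * blockMonomial e' b) := by
  simp only [blockPoly, Finset.sum_mul_sum, map_sum, smul_mul_smul_comm, map_smul, smul_eq_mul]

lemma IsPseudoExpectation.blockPoly_sq_le_one (h : IsPseudoExpectation PE t)
    (ht : 4 * (k * d) ≤ t) (e : Fin d → Fin n × Fin d) (c : (Fin k → Fin d → A) → ℝ)
    (hc0 : ∀ a, 0 ≤ c a) (hc1 : ∀ a, c a ≤ 1) :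
    PE (blockPoly e c ^ 2) ≤ 1 := by
  have hone : PE (blockPoly e (fun _ => 1) * blockPoly e (fun _ => 1)) = 1 := by
    have hdeg := totalDegree_blockPoly_le (A := A) (k := k) e (fun _ => 1)
    rw [h.mul_blockPoly_one e _ (by omega), ← one_mul (blockPoly e _),
      h.mul_blockPoly_one e _ (by simp; omega), h.1]
  rw [← hone, sq, PE_blockPoly_mul_blockPoly, PE_blockPoly_mul_blockPoly]
  refine Finset.sum_le_sum fun a _ => Finset.sum_le_sum fun b _ => ?_
  exact mul_le_mul_of_nonneg_right (mul_le_mul (hc1 a) (hc1 b) (hc0 b) zero_le_one)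
    (h.blockMonomial_mul_nonneg ht e a b)

/-- The pseudocovariance of two blocks of coordinates, as a sum over matrices of symbols. -/
lemma CovF_image_eq (F : MvPolynomial (SoSVar k n d A) ℝ → ℝ) {e e' : Fin d → Fin n × Fin d}
    (he : Function.Injective e) (he' : Function.Injective e') :
    CovF F (Finset.univ ×ˢ Finset.univ.image e) (Finset.univ ×ˢ Finset.univ.image e')
      = ∑ a : Fin k → Fin d → A, ∑ b : Fin k → Fin d → A,
          |F (blockMonomial e a * blockMonomial e' b)
            - F (blockMonomial e a) * F (blockMonomial e' b)| := by
  have key : ∀ {e : Fin d → Fin n × Fin d}, Function.Injective e →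
      ∃ φ : ({x // x ∈ (Finset.univ : Finset (Fin k)) ×ˢ Finset.univ.image e} → A)
          ≃ (Fin k → Fin d → A), ∀ γ, ZA _ γ = blockMonomial e (φ γ) := by
    intro e he
    let f : Fin k × Fin d → {x // x ∈ (Finset.univ : Finset (Fin k)) ×ˢ Finset.univ.image e} :=
      fun p => ⟨(p.1, e p.2), by simp⟩
    have hf : Function.Bijective f := by
      constructor
      · rintro ⟨i, j⟩ ⟨i', j'⟩ hij
        simp only [f, Subtype.mk.injEq, Prod.mk.injEq] at hij
        exact Prod.ext hij.1 (he hij.2)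
      · rintro ⟨⟨i, x⟩, hx⟩
        obtain ⟨j, -, rfl⟩ := Finset.mem_image.1 (Finset.mem_product.1 hx).2
        exact ⟨(i, j), rfl⟩
    refine ⟨((Equiv.ofBijective f hf).arrowCongr (Equiv.refl A)).symm.trans
      (Equiv.curry _ _ _), fun γ => ?_⟩
    rw [blockMonomial, ← Fintype.prod_prod_type' fun (i : Fin k) (j : Fin d) =>
      (X (i, e j, _) : MvPolynomial (SoSVar k n d A) ℝ), ZA,
      ← (Equiv.ofBijective f hf).prod_comp]
    rfl
  obtain ⟨φ, hφ⟩ := key he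
  obtain ⟨ψ, hψ⟩ := key he'
  rw [CovF, ← φ.sum_comp]
  refine Finset.sum_congr rfl fun a _ => ?_
  rw [← ψ.sum_comp]
  exact Finset.sum_congr rfl fun b _ => by rw [hφ, hψ]

lemma blockPoly_cov_le (PE : MvPolynomial (SoSVar k n d A) ℝ →ₗ[ℝ] ℝ)
    {e e' : Fin d → Fin n × Fin d} (he : Function.Injective e) (he' : Function.Injective e')
    (c c' : (Fin k → Fin d → A) → ℝ) (hc : ∀ a, |c a| ≤ 1) (hc' : ∀ a, |c' a| ≤ 1) :
    PE (blockPoly e c * blockPoly e' c') - PE (blockPoly e c) * PE (blockPoly e' c')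
      ≤ CovF (fun p => PE p) (Finset.univ ×ˢ Finset.univ.image e)
          (Finset.univ ×ˢ Finset.univ.image e') := by
  have hlin : ∀ (e : Fin d → Fin n × Fin d) (c : (Fin k → Fin d → A) → ℝ),
      PE (blockPoly e c) = ∑ a, c a * PE (blockMonomial e a) := fun e c => by
    simp only [blockPoly, map_sum, map_smul, smul_eq_mul]
  rw [CovF_image_eq _ he he', PE_blockPoly_mul_blockPoly, hlin, hlin, Finset.sum_mul_sum,
    ← Finset.sum_sub_distrib]
  refine Finset.sum_le_sum fun a _ => ?_
  rw [← Finset.sum_sub_distrib]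
  refine Finset.sum_le_sum fun b _ => ?_
  rw [mul_mul_mul_comm (c a), ← mul_sub]
  refine (le_abs_self _).trans ?_
  rw [abs_mul, abs_mul]
  exact mul_le_of_le_one_left (abs_nonneg _) (mul_le_one₀ (hc a) (abs_nonneg _) (hc' b))

omit [Fintype A] in
lemma sum_PE_linearCombination_sq (PE : MvPolynomial (SoSVar k n d A) ℝ →ₗ[ℝ] ℝ)
    {m : Type*} [Fintype m] (C : Matrix m (Fin n) ℝ)
    (v : Fin n → MvPolynomial (SoSVar k n d A) ℝ) :
    ∑ s, PE ((∑ r, C s r • v r) ^ 2)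
      = ∑ r, ∑ r', (C.transpose * C) r r' * PE (v r * v r') := by
  simp only [sq, Finset.sum_mul_sum, map_sum, smul_mul_smul_comm, map_smul, smul_eq_mul]
  simp only [Matrix.mul_apply, Matrix.transpose_apply, Finset.sum_mul]
  rw [Finset.sum_comm]
  exact Finset.sum_congr rfl fun r _ => Finset.sum_comm

/-- The biadjacency matrix, normalized and with its top singular component removed. -/
def centeredBiadj (eR : Fin n × Fin d ≃ Fin n × Fin d) : Matrix (Fin n) (Fin n) ℝ :=
  fun ℓ r => (∑ j : Fin d, if (eR (ℓ, j)).1 = r then 1 else 0) / d - 1 / n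

lemma sum_centeredBiadj_smul {V : Type*} [AddCommGroup V] [Module ℝ V]
    (eR : Fin n × Fin d ≃ Fin n × Fin d) (v : Fin n → V) (ℓ : Fin n) :
    ∑ r, centeredBiadj eR ℓ r • v r
      = (1 / d : ℝ) • (∑ j : Fin d, v (eR (ℓ, j)).1) - (1 / n : ℝ) • ∑ r, v r := by
  simp only [centeredBiadj, sub_smul, Finset.sum_sub_distrib, ← Finset.smul_sum, div_eq_inv_mul,
    mul_one, mul_smul, Finset.sum_smul, ite_smul, one_smul, zero_smul]
  rw [Finset.sum_comm]
  simp

lemma SingularBound.posSemidef {eR : Fin n × Fin d ≃ Fin n × Fin d} {lam : ℝ}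
    (h : SingularBound eR lam) {μ : ℝ} (hμ : lam ≤ μ) :
    (μ ^ 2 • (1 : Matrix (Fin n) (Fin n) ℝ)
      - (centeredBiadj eR).transpose * centeredBiadj eR).PosSemidef := by
  refine Matrix.PosSemidef.of_dotProduct_mulVec_nonneg ?_ fun x => ?_
  · rw [Matrix.IsHermitian, Matrix.conjTranspose_eq_transpose_of_trivial]
    simp [Matrix.transpose_mul]
  · have hx := (h x).trans (mul_le_mul_of_nonneg_right hμ (Real.sqrt_nonneg _))
    have hx2 := pow_le_pow_left₀ (Real.sqrt_nonneg _) hx 2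
    rw [mul_pow, Real.sq_sqrt (Finset.sum_nonneg fun _ _ => sq_nonneg _),
      Real.sq_sqrt (Finset.sum_nonneg fun _ _ => sq_nonneg _)] at hx2
    have hM : ∀ ℓ, ((centeredBiadj eR).mulVec x) ℓ
        = (∑ j : Fin d, x ((eR (ℓ, j)).1)) / d - (∑ r : Fin n, x r) / n := fun ℓ => by
      have := sum_centeredBiadj_smul eR x ℓ
      simp only [smul_eq_mul] at this
      rw [Matrix.mulVec, dotProduct, this]
      ring
    rw [Matrix.sub_mulVec, dotProduct_sub, ← Matrix.mulVec_mulVec, Matrix.dotProduct_mulVec _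
      (Matrix.transpose _), Matrix.vecMul_transpose, star_trivial, Matrix.smul_mulVec,
      Matrix.one_mulVec, dotProduct_smul, smul_eq_mul, sub_nonneg]
    simp only [dotProduct, hM, ← sq]
    exact hx2

open scoped MatrixOrder Matrix.Norms.L2Operator in
/-- Expander mixing lemma for pseudoexpectations. -/
lemma IsPseudoExpectation.sum_mul_centeredBiadj_le (h : IsPseudoExpectation PE t)
    {eR : Fin n × Fin d ≃ Fin n × Fin d} {lam : ℝ} (hsing : SingularBound eR lam)
    {μ : ℝ} (hμ : lam ≤ μ) (hμ0 : 0 < μ) {s : ℕ} (hs : 2 * s ≤ t)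
    (u v : Fin n → MvPolynomial (SoSVar k n d A) ℝ)
    (hu : ∀ ℓ, (u ℓ).totalDegree ≤ s) (hv : ∀ r, (v r).totalDegree ≤ s)
    (hu1 : ∀ ℓ, PE (u ℓ ^ 2) ≤ 1) (hv1 : ∀ r, PE (v r ^ 2) ≤ 1) :
    ∑ ℓ, PE (u ℓ * ∑ r, centeredBiadj eR ℓ r • v r) ≤ n * μ := by
  have hdeg : ∀ c : Fin n → ℝ, (∑ r, c r • v r).totalDegree ≤ s := fun c =>
    totalDegree_finsetSum_le fun r _ => (totalDegree_smul_le _ _).trans (hv r)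
  have hw : ∑ ℓ, PE ((∑ r, centeredBiadj eR ℓ r • v r) ^ 2) ≤ n * μ ^ 2 := by
    obtain ⟨B, hB⟩ := CStarAlgebra.nonneg_iff_eq_star_mul_self.1
      (hsing.posSemidef hμ).nonneg
    rw [Matrix.star_eq_conjTranspose, Matrix.conjTranspose_eq_transpose_of_trivial] at hB
    have hpos : 0 ≤ ∑ l, PE ((∑ r, B l r • v r) ^ 2) :=
      Finset.sum_nonneg fun l _ => h.2.1 _ (by have := hdeg (B l); omega)
    rw [sum_PE_linearCombination_sq, ← hB] at hpos
    simp only [Matrix.sub_apply, Matrix.smul_apply, sub_mul, Finset.sum_sub_distrib,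
      smul_eq_mul] at hpos
    rw [← sum_PE_linearCombination_sq] at hpos
    simp only [Matrix.one_apply, mul_ite, mul_one, mul_zero, ite_mul, zero_mul,
      Finset.sum_ite_eq, Finset.mem_univ, if_true, ← sq] at hpos
    have hle : ∑ r, μ ^ 2 * PE (v r ^ 2) ≤ ∑ _r : Fin n, μ ^ 2 :=
      Finset.sum_le_sum fun r _ => mul_le_of_le_one_right (sq_nonneg _) (hv1 r)
    simp only [Finset.sum_const, Finset.card_univ, Fintype.card_fin, nsmul_eq_mul] at hle
    linarith
  have hterm : ∀ ℓ, 2 * μ * PE (u ℓ * ∑ r, centeredBiadj eR ℓ r • v r)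
      ≤ μ ^ 2 + PE ((∑ r, centeredBiadj eR ℓ r • v r) ^ 2) := by
    intro ℓ
    have hdegw := hdeg (centeredBiadj eR ℓ)
    set w := ∑ r, centeredBiadj eR ℓ r • v r
    have hsub := totalDegree_sub (μ • u ℓ) w
    have hmu := (totalDegree_smul_le μ (u ℓ)).trans (hu ℓ)
    have h0 := h.2.1 (μ • u ℓ - w) (by omega)
    have hexp : (μ • u ℓ - w) ^ 2 = (μ ^ 2) • u ℓ ^ 2 - (2 * μ) • (u ℓ * w) + w ^ 2 := by
      simp only [smul_eq_C_mul, map_mul, map_pow, map_ofNat]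
      ring
    rw [hexp, map_add, map_sub, map_smul, map_smul, smul_eq_mul, smul_eq_mul] at h0
    have := mul_le_of_le_one_right (sq_nonneg μ) (hu1 ℓ)
    linarith
  have hsum := Finset.sum_le_sum fun ℓ (_ : ℓ ∈ Finset.univ) => hterm ℓ
  rw [← Finset.mul_sum, Finset.sum_add_distrib] at hsum
  simp only [Finset.sum_const, Finset.card_univ, Fintype.card_fin, nsmul_eq_mul] at hsum
  refine le_of_mul_le_mul_left (a := 2 * μ) ?_ (by positivity)
  linarith

end PseudoExpectation

lemma Lam_eq_blockPoly (τ : Finpartition (Finset.univ : Finset (Fin k))) (ℓ : Fin n) :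
    (Lam τ ℓ : MvPolynomial (SoSVar k n d A) ℝ) = blockPoly (fun j => (ℓ, j))
      (fun a => if ∀ i i' : Fin k, (a i = a i' ↔ SamePart τ i i') then 1 else 0) := by
  simp only [Lam, blockPoly, ite_smul, one_smul, zero_smul]
  rfl

/-- The indicator that the rows in `S` all differ from `g` around the right vertex `r`. -/
def errorIndicator (eR : Fin n × Fin d ≃ Fin n × Fin d) (g : Fin n × Fin d → A)
    (S : Finset (Fin k)) (r : Fin n) (a : Fin k → Fin d → A) : ℝ :=
  if ∀ i ∈ S, a i ≠ fun j => g (eR.symm (r, j)) then 1 else 0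

lemma blockPoly_errorIndicator (eR : Fin n × Fin d ≃ Fin n × Fin d) (g : Fin n × Fin d → A)
    (S : Finset (Fin k)) (r : Fin n) :
    blockPoly (fun j => eR.symm (r, j)) (errorIndicator eR g S r)
      = Dpoly eR g S r * ∏ i ∈ Sᶜ, ∏ j : Fin d, ∑ σ : A, X (i, eR.symm (r, j), σ) := by
  have hfun : errorIndicator eR g S r = fun a => ∏ i, (fun (i : Fin k) (b : Fin d → A) =>
      if i ∈ S then (if b ≠ fun j => g (eR.symm (r, j)) then (1 : ℝ) else 0) else 1) i (a i) := by
    funext a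
    simp only [Finset.prod_ite_mem, Finset.univ_inter]
    rw [errorIndicator]
    split_ifs with h
    · exact (Finset.prod_eq_one fun i hi => if_pos (h i hi)).symm
    · push Not at h
      obtain ⟨i, hi, hg⟩ := h
      exact (Finset.prod_eq_zero hi (if_neg (not_not.2 hg))).symm
  rw [hfun]
  refine (blockPoly_prod _ (fun (i : Fin k) (b : Fin d → A) =>
    if i ∈ S then (if b ≠ fun j => g (eR.symm (r, j)) then (1 : ℝ) else 0) else 1)).trans ?_
  rw [Dpoly, ← Finset.prod_mul_prod_compl S]
  congr 1
  · refine Finset.prod_congr rfl fun i hi => Finset.sum_congr rfl fun a _ => ?_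
    simp only [hi, if_true, ite_smul, one_smul, zero_smul]
    rfl
  · refine Finset.prod_congr rfl fun i hi => ?_
    rw [prod_sum_X_eq_sum_prod (fun j => eR.symm (r, j))]
    simp only [Finset.mem_compl.1 hi, if_false, one_smul]

lemma totalDegree_Dpoly_le (eR : Fin n × Fin d ≃ Fin n × Fin d) (g : Fin n × Fin d → A)
    (S : Finset (Fin k)) (r : Fin n) : (Dpoly eR g S r).totalDegree ≤ S.card * d := by
  unfold Dpoly
  refine (totalDegree_finsetProd _ _).trans ?_
  refine (Finset.sum_le_card_nsmul _ _ d fun i _ => totalDegree_finsetSum_le fun a _ => ?_).trans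
    (by simp)
  split_ifs
  · exact (totalDegree_finsetProd _ _).trans (by simp [totalDegree_X])
  · simp

lemma IsPseudoExpectation.mul_Dpoly {PE : MvPolynomial (SoSVar k n d A) ℝ →ₗ[ℝ] ℝ} {t : ℕ}
    (h : IsPseudoExpectation PE t) (eR : Fin n × Fin d ≃ Fin n × Fin d)
    (g : Fin n × Fin d → A) (S : Finset (Fin k)) (r : Fin n)
    (q : MvPolynomial (SoSVar k n d A) ℝ) (hq : q.totalDegree + k * d ≤ t) :
    PE (q * Dpoly eR g S r)
      = PE (q * blockPoly (fun j => eR.symm (r, j)) (errorIndicator eR g S r)) := by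
  have hD := totalDegree_Dpoly_le eR g S r
  have hmul := totalDegree_mul q (Dpoly eR g S r)
  have hcard : S.card * d + Sᶜ.card * d = k * d := by
    rw [← add_mul, Finset.card_add_card_compl, Fintype.card_fin]
  have hprod : (∏ i ∈ Sᶜ, ∏ j : Fin d, ∑ σ : A, X (i, eR.symm (r, j), σ) :
      MvPolynomial (SoSVar k n d A) ℝ) = ∏ u ∈ Sᶜ ×ˢ (Finset.univ : Finset (Fin d)),
        ∑ σ : A, X (u.1, eR.symm (r, u.2), σ) := by
    rw [Finset.prod_product]
  rw [blockPoly_errorIndicator, ← mul_assoc, hprod]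
  exact (h.mul_prod_sum_X (Sᶜ ×ˢ (Finset.univ : Finset (Fin d)))
    (fun u => (u.1, eR.symm (r, u.2))) _ (by
      rw [Finset.card_product, Finset.card_univ, Fintype.card_fin]; omega)).symm

lemma blockPoly_sub (e : Fin d → Fin n × Fin d) (c c' : (Fin k → Fin d → A) → ℝ) :
    blockPoly e c - blockPoly e c' = blockPoly e (c - c') := by
  simp only [blockPoly, Pi.sub_apply, sub_smul, Finset.sum_sub_distrib]

/-- more common errors on a part of the partition. -/
theorem sos_more_common_errors
    {A : Type*} [Fintype A]
    (k n d : ℕ) (hk : 1 ≤ k) (hn : 0 < n) (hd : 0 < d)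
    (ε β lam η : ℝ) (hε : 0 < ε) (hβ : 0 < β)
    (eR : Fin n × Fin d ≃ Fin n × Fin d)
    (Cin : Set (Fin d → A))
    (hsing : SingularBound eR lam)
    (t : ℕ) (ht : 4 * k * d ≤ t)
    (PE : MvPolynomial (SoSVar k n d A) ℝ →ₗ[ℝ] ℝ)
    (hPE : IsPseudocodeword Cin PE t)
    (hgood : EtaGood eR PE η)
    (hlam : lam ≤ β * ε / (12 * (k : ℝ) ^ k))
    (hη : η ≤ β * ε / (12 * (k : ℝ) ^ k))
    (τ : Finpartition (Finset.univ : Finset (Fin k))) (hτ : 2 ≤ τ.parts.card)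
    (hτmass : β / (k : ℝ) ^ k ≤ (∑ ℓ : Fin n, PE (Lam τ ℓ)) / n)
    (g : Fin n × Fin d → A) :
    ∀ P ∈ τ.parts,
      pdeltaR eR PE g Finset.univ
          + ((∑ e : Fin n × Fin d,
                PE (Lam τ e.1 * (Dpoly eR g P (eR e).1 - Dpoly eR g Finset.univ (eR e).1)))
                / ((n : ℝ) * d))
              / ((∑ ℓ : Fin n, PE (Lam τ ℓ)) / n)
          - ε / 6
        ≤ pdeltaR eR PE g P := by
  intro P _
  have hpe := hPE.1
  have hkd : 4 * (k * d) ≤ t := by rw [← mul_assoc]; exact ht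
  have hk0 : (0 : ℝ) < (k : ℝ) ^ k := pow_pos (by exact_mod_cast hk) _
  have hn0 : (0 : ℝ) < n := by exact_mod_cast hn
  have hd0 : (0 : ℝ) < d := by exact_mod_cast hd
  set μ := β * ε / (12 * (k : ℝ) ^ k) with hμdef
  have hμ0 : 0 < μ := by positivity
  set m := (∑ ℓ : Fin n, PE (Lam τ ℓ)) / n with hmdef
  have hm0 : 0 < m := lt_of_lt_of_le (by positivity) hτmass
  let c : Fin n → (Fin k → Fin d → A) → ℝ := fun r =>
    errorIndicator eR g P r - errorIndicator eR g Finset.univ r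
  let F : Fin n → MvPolynomial (SoSVar k n d A) ℝ := fun r =>
    blockPoly (fun j => eR.symm (r, j)) (c r)
  have hc : ∀ r a, 0 ≤ c r a ∧ c r a ≤ 1 := by
    intro r a
    simp only [c, Pi.sub_apply, errorIndicator]
    by_cases h1 : ∀ i ∈ (Finset.univ : Finset (Fin k)), a i ≠ fun j => g (eR.symm (r, j))
    · rw [if_pos h1, if_pos fun i _ => h1 i (Finset.mem_univ i)]
      norm_num
    · rw [if_neg h1]
      split_ifs <;> norm_num
  have hF : ∀ r (q : MvPolynomial (SoSVar k n d A) ℝ), q.totalDegree ≤ k * d →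
      PE (q * (Dpoly eR g P r - Dpoly eR g Finset.univ r)) = PE (q * F r) := by
    intro r q hq
    rw [mul_sub, map_sub, hpe.mul_Dpoly eR g P r q (by omega),
      hpe.mul_Dpoly eR g Finset.univ r q (by omega), ← map_sub, ← mul_sub, blockPoly_sub]
  have hLdeg : ∀ ℓ, (Lam τ ℓ : MvPolynomial (SoSVar k n d A) ℝ).totalDegree ≤ k * d := fun ℓ => by
    rw [Lam_eq_blockPoly]
    exact totalDegree_blockPoly_le _ _
  have hLsq : ∀ ℓ : Fin n, PE (Lam τ ℓ ^ 2) ≤ 1 := fun ℓ => by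
    rw [Lam_eq_blockPoly]
    exact hpe.blockPoly_sq_le_one hkd _ _ (fun a => by split_ifs <;> norm_num)
      (fun a => by split_ifs <;> norm_num)
  have hmix := hpe.sum_mul_centeredBiadj_le hsing hlam hμ0 (s := k * d) (by omega)
    (fun ℓ => Lam τ ℓ) F hLdeg (fun r => totalDegree_blockPoly_le _ _) hLsq
    (fun r => hpe.blockPoly_sq_le_one hkd _ _ (fun a => (hc r a).1) fun a => (hc r a).2)
  simp only [sum_centeredBiadj_smul, mul_sub, mul_smul_comm, map_sub, map_smul, smul_eq_mul,
    Finset.mul_sum, map_sum, Finset.sum_sub_distrib] at hmix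
  simp only [← Finset.mul_sum] at hmix
  have hcov : ∑ ℓ : Fin n, ∑ r, PE (Lam τ ℓ * F r)
      ≤ (∑ ℓ : Fin n, PE (Lam τ ℓ)) * (∑ r, PE (F r)) + n * n * μ := by
    have hsum : ∑ ℓ : Fin n, ∑ r, (PE (Lam τ ℓ * F r) - PE (Lam τ ℓ) * PE (F r))
        ≤ ∑ ℓ : Fin n, ∑ r : Fin n, CovF (fun p => PE p) (KNL k d ℓ) (KNR k eR r) := by
      refine Finset.sum_le_sum fun ℓ _ => Finset.sum_le_sum fun r _ => ?_
      rw [Lam_eq_blockPoly]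
      exact blockPoly_cov_le PE (fun _ _ h => (Prod.ext_iff.1 h).2)
        (fun _ _ h => (Prod.ext_iff.1 (eR.symm.injective h)).2) _ _
        (fun a => by split_ifs <;> norm_num)
        (fun a => abs_le.2 ⟨by linarith [(hc r a).1], (hc r a).2⟩)
    have hgood' := (div_le_iff₀ (by positivity)).1 (hgood.trans hη)
    simp only [Finset.sum_sub_distrib] at hsum
    rw [Finset.sum_mul_sum]
    linarith
  have hedge : ∑ e : Fin n × Fin d,
      PE (Lam τ e.1 * (Dpoly eR g P (eR e).1 - Dpoly eR g Finset.univ (eR e).1))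
        = ∑ ℓ : Fin n, ∑ j : Fin d, PE (Lam τ ℓ * F (eR (ℓ, j)).1) := by
    rw [Fintype.sum_prod_type]
    exact Finset.sum_congr rfl fun ℓ _ => Finset.sum_congr rfl fun j _ => hF _ _ (hLdeg ℓ)
  have hdiff : pdeltaR eR PE g P - pdeltaR eR PE g Finset.univ = (∑ r, PE (F r)) / n := by
    rw [pdeltaR, pdeltaR, ← sub_div, ← Finset.sum_sub_distrib]
    congr 1
    refine Finset.sum_congr rfl fun r _ => ?_
    have := hF r 1 (by simp)
    rwa [one_mul, one_mul, map_sub] at this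
  rw [hedge]
  set E := ∑ ℓ : Fin n, ∑ j : Fin d, PE (Lam τ ℓ * F (eR (ℓ, j)).1)
  set G := ∑ ℓ : Fin n, ∑ r, PE (Lam τ ℓ * F r)
  set f := ∑ r, PE (F r)
  have hsumLam : ∑ ℓ : Fin n, PE (Lam τ ℓ) = m * n := by rw [hmdef]; field_simp
  have hE : E / (n * d) ≤ m * (f / n) + 2 * μ := by
    have h1 : E / (n * d) - G / (n * n) ≤ μ := by
      have h2 : E / (n * d) - G / (n * n) = (1 / d * E - 1 / n * G) / n := by field_simp
      rw [h2, div_le_iff₀ hn0]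
      linarith
    have h2 : G / (n * n) ≤ m * (f / n) + μ := by
      rw [hsumLam] at hcov
      rw [div_le_iff₀ (by positivity)]
      refine hcov.trans (le_of_eq ?_)
      field_simp
    linarith
  have hμm : 2 * μ ≤ ε / 6 * m := by
    have := mul_le_mul_of_nonneg_left hτmass (by positivity : 0 ≤ ε / 6)
    refine le_trans (le_of_eq ?_) this
    rw [hμdef]
    field_simp
    norm_num
  have hquot : E / (n * d) / m ≤ f / n + ε / 6 := by
    rw [div_le_iff₀ hm0]
    linarith
  linarith
end
end
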